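/- arXiv:0804.3134 — 2 statements merged into one kernel-verified Lean document; each statement's English description precedes it below -/
import Mathlib

section
/- Let g ≥ 3 and let N ≥ 3 be odd. Let Γ_g(N) be the principal congruence subgroup of level N, i.e. the kernel of the reduction homomorphism Sp_{2g}(ℤ) → Sp_{2g}(ℤ/Nℤ). Then the abelianization of Γ_g(N) is isomorphic as a group to the additive group sp_{2g}(ℤ/Nℤ). -/
open Matrix

/-- The paper's standard symplectic form matrix `J = [[0, 1_g], [-1_g, 0]]`. -/
def paperJ (l R : Type*) [DecidableEq l] [CommRing R] : Matrix (l ⊕ l) (l ⊕ l) R :=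
  Matrix.fromBlocks 0 1 (-1) 0

/-- The paper's symplectic condition `ᵀM·J·M = J` (with `J = [[0, 1_g], [-1_g, 0]]`)
characterizes membership in Mathlib's `Matrix.symplecticGroup`; hence the latter *is* the
symplectic group `Sp_{2g}(R)` of the paper. -/
theorem mem_symplecticGroup_iff_paper {l R : Type*} [DecidableEq l] [Fintype l] [CommRing R]
    (M : Matrix (l ⊕ l) (l ⊕ l) R) :
    M ∈ Matrix.symplecticGroup l R ↔ Mᵀ * paperJ l R * M = paperJ l R := by
  have hJ : paperJ l R = -(Matrix.J l R) := by
    rw [paperJ, Matrix.J, Matrix.fromBlocks_neg]; norm_num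
  rw [SymplecticGroup.mem_iff', hJ]
  constructor
  · intro h; rw [Matrix.mul_neg, Matrix.neg_mul, h]
  · intro h
    have := congrArg Neg.neg h
    simpa [Matrix.mul_neg, Matrix.neg_mul] using this

/-- The Lie algebra `sp_{2g}(R)`: the `R`-module of matrices `X` with `ᵀX·J + J·X = 0`. -/
def spLie (l R : Type*) [DecidableEq l] [Fintype l] [CommRing R] :
    Submodule R (Matrix (l ⊕ l) (l ⊕ l) R) where
  carrier := {X | Xᵀ * paperJ l R + paperJ l R * X = 0}
  add_mem' := by
    intro a b ha hb
    simp only [Set.mem_setOf_eq] at *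
    rw [Matrix.transpose_add, Matrix.add_mul, Matrix.mul_add]
    calc aᵀ * paperJ l R + bᵀ * paperJ l R + (paperJ l R * a + paperJ l R * b)
        = (aᵀ * paperJ l R + paperJ l R * a) + (bᵀ * paperJ l R + paperJ l R * b) := by abel
      _ = 0 := by rw [ha, hb, add_zero]
  zero_mem' := by simp
  smul_mem' := by
    intro c x hx
    simp only [Set.mem_setOf_eq] at *
    rw [Matrix.transpose_smul, Matrix.smul_mul, Matrix.mul_smul, ← smul_add, hx, smul_zero]

theorem J_map_intCast (g N : ℕ) :
    (Matrix.J (Fin g) ℤ).map (Int.castRingHom (ZMod N)) = Matrix.J (Fin g) (ZMod N) := by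
  ext i j
  rcases i with i | i <;> rcases j with j | j <;>
    simp [Matrix.J, Matrix.fromBlocks, Matrix.map_apply, Matrix.one_apply, apply_ite] <;>
      split_ifs <;> simp_all

/-- Entrywise reduction modulo `N` gives a group homomorphism
`Sp_{2g}(ℤ) →* Sp_{2g}(ℤ/Nℤ)`. -/
noncomputable def spIntRed (g N : ℕ) :
    ↥(Matrix.symplecticGroup (Fin g) ℤ) →* ↥(Matrix.symplecticGroup (Fin g) (ZMod N)) where
  toFun M := ⟨(M : Matrix (Fin g ⊕ Fin g) (Fin g ⊕ Fin g) ℤ).map (Int.castRingHom (ZMod N)), by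
    have hM : (M : Matrix (Fin g ⊕ Fin g) (Fin g ⊕ Fin g) ℤ) * Matrix.J (Fin g) ℤ *
        (M : Matrix (Fin g ⊕ Fin g) (Fin g ⊕ Fin g) ℤ)ᵀ = Matrix.J (Fin g) ℤ :=
      SymplecticGroup.mem_iff.mp M.2
    rw [SymplecticGroup.mem_iff, ← J_map_intCast g N, ← Matrix.transpose_map,
      ← Matrix.map_mul, ← Matrix.map_mul, hM]⟩
  map_one' := by
    apply Subtype.ext
    show (1 : Matrix (Fin g ⊕ Fin g) (Fin g ⊕ Fin g) ℤ).map _ = _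
    exact Matrix.map_one _ (map_zero _) (map_one _)
  map_mul' a b := by
    apply Subtype.ext
    show ((a : Matrix (Fin g ⊕ Fin g) (Fin g ⊕ Fin g) ℤ) * b).map _ = _
    exact Matrix.map_mul

/-- A pair `(a, b)` that occurs as the first row of a matrix in the principal congruence subgroup
of level `n` of `SL₂(ℤ)`. -/
structure IsLevelRow (n a b : ℤ) : Prop where
  dvd_sub_one : n ∣ a - 1
  dvd_right : n ∣ b
  isCoprime : IsCoprime a b

/-- The invariance properties shared by the two symbols attached to long and short roots. -/
structure IsRowSymbol {C : Type*} [CommGroup C] (n : ℤ) (s : ℤ → ℤ → C) : Prop where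
  add_right : ∀ a b t, IsLevelRow n a b → s a (b + n * t * a) = s a b
  add_left : ∀ a b t, IsLevelRow n a b → s (a + t * b) b = s a b
  one_zero : s 1 0 = 1

theorem isCoprime_of_dvd_sub_one {n a : ℤ} (h : n ∣ a - 1) : IsCoprime a n := by
  obtain ⟨k, hk⟩ := h
  exact ⟨1, -k, by linear_combination hk⟩

theorem IsLevelRow.of_mul {n a x : ℤ} (ha : n ∣ a - 1) (hx : IsCoprime a x) :
    IsLevelRow n a (n * x) :=
  ⟨ha, dvd_mul_right _ _, (isCoprime_of_dvd_sub_one ha).mul_right hx⟩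

theorem IsLevelRow.add_left {n a b : ℤ} (h : IsLevelRow n a b) (t : ℤ) :
    IsLevelRow n (a + t * b) b := by
  refine ⟨?_, h.2, h.3.add_mul_right_left t⟩
  exact (dvd_add h.1 (h.2.mul_left t)).trans (dvd_of_eq (by ring))

theorem IsLevelRow.add_right {n a b : ℤ} (h : IsLevelRow n a b) (t : ℤ) :
    IsLevelRow n a (b + n * t * a) :=
  ⟨h.1, dvd_add h.2 (dvd_mul_of_dvd_left (dvd_mul_right _ _) _), h.3.add_mul_right_right (n * t)⟩

theorem IsLevelRow.mul_right {n a b c : ℤ} (h : IsLevelRow n a b) (h' : IsCoprime a c) :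
    IsLevelRow n a (b * c) :=
  ⟨h.1, h.2.mul_right _, h.3.mul_right h'⟩

theorem exists_prime_dvd_sub_dvd_add_one {m k a : ℤ} (hm : m ≠ 0) (hk : k ≠ 0)
    (hmk : IsCoprime m k) (ha : IsCoprime a m) :
    ∃ p : ℕ, 2 < p ∧ p.Prime ∧ m ∣ (p : ℤ) - a ∧ k ∣ (p : ℤ) + 1 := by
  obtain ⟨u, v, huv⟩ := hmk
  have hcop : IsCoprime (a * (v * k) - u * m) ((m * k).natAbs : ℤ) := by
    have : IsCoprime (a * (v * k) - u * m) (m * k) := by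
      refine IsCoprime.mul_right ?_ ?_
      · have h1 : IsCoprime (a * (v * k)) m :=
          IsCoprime.mul_left ha ⟨1, u, by linear_combination huv⟩
        simpa [sub_eq_add_neg, mul_comm] using h1.add_mul_left_left (-u)
      · exact ⟨-1, a * v + v, by linear_combination huv⟩
    exact this.of_isCoprime_of_dvd_right Int.natAbs_dvd_self
  obtain ⟨p, hp2, hp, hpm⟩ := Nat.forall_exists_prime_gt_and_zmodEq 2
    (q := (m * k).natAbs) (by simp [hm, hk]) hcop
  have hpm := Int.natAbs_dvd.1 hpm.symm.dvd
  refine ⟨p, hp2, hp, ?_, ?_⟩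
  · exact (dvd_add ((dvd_mul_right _ _).trans hpm) (dvd_mul_right m (-a * u - u))).trans
      (dvd_of_eq (by linear_combination -a * huv))
  · exact (dvd_add ((dvd_mul_left _ _).trans hpm) (dvd_mul_right k (a * v + v))).trans
      (dvd_of_eq (by linear_combination huv))

namespace IsRowSymbol

variable {C : Type*} [CommGroup C] {n : ℤ} {s f : ℤ → ℤ → C}

theorem one_left (hs : IsRowSymbol n s) {b : ℤ} (hb : n ∣ b) : s 1 b = 1 := by
  obtain ⟨k, rfl⟩ := hb
  have := hs.add_right 1 0 k ⟨by simp, by simp, isCoprime_one_left⟩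
  rw [hs.one_zero] at this
  simpa using this

theorem congr_left (hs : IsRowSymbol n s) {a a' b : ℤ} (h : IsLevelRow n a b)
    (haa : b ∣ a' - a) : s a' b = s a b := by
  obtain ⟨k, hk⟩ := haa
  have := hs.add_left a b k h
  rwa [show a + k * b = a' by linear_combination -hk] at this

theorem eq_one_of_dvd (hs : IsRowSymbol n s) {a b : ℤ} (hb : n ∣ b) (h : b ∣ a - 1) :
    s a b = 1 := by
  rw [hs.congr_left (a := 1) ⟨by simp, hb, isCoprime_one_left⟩ h, hs.one_left hb]

theorem congr_right (hs : IsRowSymbol n s) {a x y : ℤ} (ha : n ∣ a - 1) (hx : IsCoprime a x)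
    (h : a ∣ y - x) : s a (n * y) = s a (n * x) := by
  obtain ⟨k, hk⟩ := h
  rw [← hs.add_right a (n * x) k (.of_mul ha hx)]
  congr 1
  linear_combination n * hk

/-- A row symbol that is multiplicative in its second argument is a homomorphism in the quotient
of the second argument by the level. -/
theorem level_mul (hs : IsRowSymbol n s)
    (hm : ∀ a b c, IsLevelRow n a b → IsLevelRow n a c → s a (b * c) = s a b * s a c)
    {a x y : ℤ} (ha : n ∣ a - 1) (hx : IsCoprime a x) (hy : IsCoprime a y) :
    s a (n * (x * y)) = s a (n * x) * s a (n * y) := by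
  have hn : s a n = 1 := hs.eq_one_of_dvd dvd_rfl ha
  have hn' : IsLevelRow n a n := ⟨ha, dvd_rfl, isCoprime_of_dvd_sub_one ha⟩
  rw [← hm _ _ _ (.of_mul ha hx) (.of_mul ha hy), show n * x * (n * y) = n * (n * (x * y)) by ring,
    hm _ _ _ hn' (.of_mul ha (hx.mul_right hy)), hn, one_mul]

theorem level_pow (hs : IsRowSymbol n s)
    (hm : ∀ a b c, IsLevelRow n a b → IsLevelRow n a c → s a (b * c) = s a b * s a c)
    {a x : ℤ} (ha : n ∣ a - 1) (hx : IsCoprime a x) (k : ℕ) :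
    s a (n * x ^ k) = s a (n * x) ^ k := by
  induction k with
  | zero => simpa using hs.eq_one_of_dvd dvd_rfl ha
  | succ k ih => rw [pow_succ, hs.level_mul hm ha hx.pow_right hx, ih, pow_succ]

/-- Every level row is the first row of a matrix of level `n`. -/
theorem _root_.IsLevelRow.exists_matrix {a b : ℤ} (h : IsLevelRow n a b) :
    ∃ c d : ℤ, a * d - b * c = 1 ∧ n ∣ c ∧ n ∣ d - 1 := by
  obtain ⟨u, v, huv⟩ := h.isCoprime
  obtain ⟨k, hk⟩ := h.dvd_sub_one
  obtain ⟨m, rfl⟩ := h.dvd_right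
  refine ⟨v * (a - 1), u + v * n * m, by linear_combination huv, ⟨k * v, by rw [hk]; ring⟩, ?_⟩
  exact ⟨-k * u, by linear_combination huv - u * hk⟩

/-- Multiplicativity in the first argument follows from multiplicativity in the second one
together with compatibility with matrix products. -/
theorem mul_left (hs : IsRowSymbol n s)
    (hm : ∀ a b c, IsLevelRow n a b → IsLevelRow n a c → s a (b * c) = s a b * s a c)
    (hp : ∀ a b c d a' b' c' d' : ℤ, a * d - b * c = 1 → a' * d' - b' * c' = 1 →
      IsLevelRow n a b → n ∣ c → n ∣ d - 1 → IsLevelRow n a' b' → n ∣ c' → n ∣ d' - 1 →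
      s (a * a' + b * c') (a * b' + b * d') = s a b * s a' b')
    {a a' x : ℤ} (ha : n ∣ a - 1) (ha' : n ∣ a' - 1) (hx : IsCoprime a x) (hx' : IsCoprime a' x) :
    s (a * a') (n * x) = s a (n * x) * s a' (n * x) := by
  have h1 := IsLevelRow.of_mul ha hx
  have h2 := IsLevelRow.of_mul ha' hx'
  obtain ⟨c, d, hd, hc, hd1⟩ := h1.exists_matrix
  obtain ⟨c', d', hd', hc', hd1'⟩ := h2.exists_matrix
  rw [← hp _ _ _ _ _ _ _ _ hd hd' h1 hc hd1 h2 hc' hd1']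
  set S := a + d' with hS
  set A := a * a' + n * x * c' with hA
  have hAS : A = a' * S - 1 := by rw [hA, hS]; linear_combination -hd'
  have haa : n ∣ a * a' - 1 := by
    exact (dvd_add (ha.mul_right a') ha').trans (dvd_of_eq (by ring))
  have hA1 : n ∣ A - 1 := by
    exact (dvd_add haa (dvd_mul_right n (x * c'))).trans (dvd_of_eq (by rw [hA]; ring))
  have hAx : IsCoprime A x := by
    rw [hA, show a * a' + n * x * c' = a * a' + n * c' * x by ring]
    exact (hx.mul_left hx').add_mul_right_left (n * c')
  have hASc : IsCoprime A S := ⟨-1, a', by rw [hAS]; ring⟩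
  have hAa : IsCoprime A a' := ⟨-1, S, by rw [hAS]; ring⟩
  have e1 : a * (n * x) + n * x * d' = n * (x * S) := by rw [hS]; ring
  rw [e1, hs.level_mul hm hA1 hAx hASc]
  have e2 : s A (n * x) = s (a * a') (n * x) :=
    hs.congr_left (.of_mul haa (hx.mul_left hx')) ⟨c', by rw [hA]; ring⟩
  have e3 : s A (n * S) * s A (n * a') = 1 := by
    rw [← hs.level_mul hm hA1 hASc hAa,
      hs.congr_right (x := 1) hA1 isCoprime_one_right ⟨1, by rw [hAS]; ring⟩, mul_one]
    exact hs.eq_one_of_dvd dvd_rfl hA1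
  have hB1 : n ∣ 2 * a' - 1 - 1 := by
    exact (ha'.mul_left 2).trans (dvd_of_eq (by ring))
  have hBa : IsCoprime (2 * a' - 1) a' := ⟨-1, 2, by ring⟩
  have hB2 : IsCoprime (2 * a' - 1) 2 := ⟨-1, a', by ring⟩
  have e4 : s A (n * a') = s (2 * a' - 1) (n * a') := by
    refine hs.congr_left (.of_mul hB1 hBa) ?_
    obtain ⟨k, hk⟩ := ha
    obtain ⟨m, hm⟩ := hd1'
    exact ⟨k + m, by rw [hAS, hS]; linear_combination a' * hk + a' * hm⟩
  have e5 : s (2 * a' - 1) (n * a') * s (2 * a' - 1) (n * 2) = 1 := by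
    rw [← hs.level_mul hm hB1 hBa hB2,
      hs.congr_right (x := 1) hB1 isCoprime_one_right ⟨1, by ring⟩, mul_one]
    exact hs.eq_one_of_dvd dvd_rfl hB1
  have e6 : s (2 * a' - 1) (n * 2) = 1 := by
    refine hs.eq_one_of_dvd (dvd_mul_right _ _) ?_
    obtain ⟨k, hk⟩ := ha'
    exact ⟨k, by linear_combination 2 * hk⟩
  rw [e6, mul_one] at e5
  rw [e4, e5, mul_one] at e3
  rw [e3, e2, mul_one]

theorem pow_left (hs : IsRowSymbol n s)
    (hm : ∀ a b c, IsLevelRow n a b → IsLevelRow n a c → s a (b * c) = s a b * s a c)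
    (hp : ∀ a b c d a' b' c' d' : ℤ, a * d - b * c = 1 → a' * d' - b' * c' = 1 →
      IsLevelRow n a b → n ∣ c → n ∣ d - 1 → IsLevelRow n a' b' → n ∣ c' → n ∣ d' - 1 →
      s (a * a' + b * c') (a * b' + b * d') = s a b * s a' b')
    {a x : ℤ} (ha : n ∣ a - 1) (hx : IsCoprime a x) (k : ℕ) :
    s (a ^ k) (n * x) = s a (n * x) ^ k := by
  induction k with
  | zero => simpa using hs.one_left (dvd_mul_right n x)
  | succ k ih =>
    rw [pow_succ, hs.mul_left hm hp ?_ ha hx.pow_left hx, ih, pow_succ]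
    exact ha.trans (by simpa using sub_dvd_pow_sub_pow a 1 k)

/-- A row symbol that is multiplicative in its second argument and compatible with matrix products
is trivial. -/
theorem eq_one_of_mul (hs : IsRowSymbol n s) (hn : Odd n) (hn1 : 1 < n)
    (hm : ∀ a b c, IsLevelRow n a b → IsLevelRow n a c → s a (b * c) = s a b * s a c)
    (hp : ∀ a b c d a' b' c' d' : ℤ, a * d - b * c = 1 → a' * d' - b' * c' = 1 →
      IsLevelRow n a b → n ∣ c → n ∣ d - 1 → IsLevelRow n a' b' → n ∣ c' → n ∣ d' - 1 →
      s (a * a' + b * c') (a * b' + b * d') = s a b * s a' b')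
    {a b : ℤ} (h : IsLevelRow n a b) : s a b = 1 := by
  obtain ⟨ha, ⟨x, rfl⟩, hc⟩ := h
  have hx : IsCoprime a x := hc.of_mul_right_right
  have han : IsCoprime a n := hc.of_mul_right_left
  have ha0 : a ≠ 0 := by
    rintro rfl
    have := Int.le_of_dvd (by norm_num) ((dvd_neg (a := n) (b := 1)).1 (by simpa using ha))
    omega
  -- a prime `q` congruent to `x` modulo `a` and to `-1` modulo `n`
  obtain ⟨q, hq2, hq, hqa, hqn⟩ :
      ∃ q : ℕ, 2 < q ∧ q.Prime ∧ a ∣ (q : ℤ) - x ∧ n ∣ (q : ℤ) + 1 := by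
    exact exists_prime_dvd_sub_dvd_add_one ha0 (by omega) han hx.symm
  have hq0 : (0 : ℤ) < q := by positivity
  have hqodd : Odd q := hq.odd_of_ne_two (by omega)
  have haq : IsCoprime a q := by
    obtain ⟨k, hk⟩ := hqa
    rw [show (q : ℤ) = x + a * k by linear_combination hk]
    exact hx.add_mul_left_right k
  rw [← hs.congr_right ha hx hqa]
  have hnq : IsCoprime n q := by
    obtain ⟨k, hk⟩ := hqn
    exact ⟨k, -1, by linear_combination -hk⟩
  have hn2 : IsCoprime n 2 := (Int.isCoprime_two_left.2 hn).symm
  have hnq1 : IsCoprime n (2 * ((q : ℤ) - 1)) := by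
    refine hn2.mul_right ?_
    obtain ⟨k, hk⟩ := hqn
    rw [show (q : ℤ) - 1 = -2 + n * k by linear_combination hk]
    exact (hn2.neg_right).add_mul_left_right k
  have hqq1 : IsCoprime (q : ℤ) (2 * ((q : ℤ) - 1)) := by
    refine IsCoprime.mul_right ?_ ⟨1, -1, by ring⟩
    exact (Int.isCoprime_two_left.2 (by exact_mod_cast hqodd)).symm
  -- a prime `p` congruent to `a` modulo `n * q` and to `-1` modulo `2 * (q - 1)`
  obtain ⟨p, hp2, hpp, hpa, hpq⟩ :
      ∃ p : ℕ, 2 < p ∧ p.Prime ∧ n * q ∣ (p : ℤ) - a ∧ 2 * ((q : ℤ) - 1) ∣ p + 1 := by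
    exact exists_prime_dvd_sub_dvd_add_one (mul_ne_zero (by omega) (by omega)) (by omega)
      (hnq1.mul_left hqq1) (han.mul_right haq)
  have hrow : IsLevelRow n a (n * q) := .of_mul ha haq
  rw [← hs.congr_left hrow hpa]
  have hp1 : n ∣ (p : ℤ) - 1 := by
    exact (dvd_add ((dvd_mul_right n (q : ℤ)).trans hpa) ha).trans (dvd_of_eq (by ring))
  have hpcop : IsCoprime (p : ℤ) q := by
    obtain ⟨k, hk⟩ := hpa
    rw [show (p : ℤ) = a + k * n * q by linear_combination hk]
    exact haq.add_mul_right_left (k * n)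
  -- the symbol is killed by `q - 1` and by `(p - 1) / 2`
  have k1 : s p (n * q) ^ (q - 1) = 1 := by
    rw [← hs.pow_left hm hp hp1 hpcop]
    refine hs.eq_one_of_dvd (dvd_mul_right _ _) (hnq.mul_dvd ?_ ?_)
    · exact hp1.trans (by simpa using sub_dvd_pow_sub_pow (p : ℤ) 1 (q - 1))
    · have := Int.ModEq.pow_card_sub_one_eq_one hq hpcop
      exact this.symm.dvd
  have := Fact.mk hpp
  have k2 : s p (n * q) ^ (p / 2) = 1 := by
    rw [← hs.level_pow hm hp1 hpcop]
    have hqp : (q : ZMod p) ≠ 0 := by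
      intro h0
      have : (p : ℤ) ∣ q := by exact_mod_cast (ZMod.natCast_eq_zero_iff q p).1 h0
      have := Int.isUnit_iff.1 (hpcop.isUnit_of_dvd' dvd_rfl this)
      omega
    rcases ZMod.pow_div_two_eq_neg_one_or_one p hqp with h1 | h1
    · rw [hs.congr_right (x := 1) hp1 isCoprime_one_right, mul_one]
      · exact hs.eq_one_of_dvd dvd_rfl hp1
      · rw [← ZMod.intCast_zmod_eq_zero_iff_dvd]
        push_cast
        rw [h1, sub_self]
    · rw [hs.congr_right (x := -1) hp1 isCoprime_one_right.neg_right]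
      · exact hs.eq_one_of_dvd (by simp) (by simpa using hp1)
      · rw [← ZMod.intCast_zmod_eq_zero_iff_dvd]
        push_cast
        rw [h1, sub_self]
  have hcop : Nat.Coprime (q - 1) (p / 2) := by
    obtain ⟨k, hk⟩ := hpq
    have hpodd := hpp.eq_two_or_odd
    have e : ((p / 2 : ℕ) : ℤ) = (q - 1) * k - 1 := by
      have : (p : ℤ) = 2 * ((p / 2 : ℕ) : ℤ) + 1 := by omega
      linarith
    rw [← Nat.isCoprime_iff_coprime, e, Nat.cast_sub (by omega)]
    exact ⟨k, -1, by push_cast; ring⟩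
  have := pow_gcd_eq_one.2 ⟨k1, k2⟩
  rwa [hcop, pow_one] at this

/-- The symbol `f` attached to long roots is trivial as soon as it is linked to a symbol `s` that
is compatible with matrix products. -/
theorem eq_one_of_link (hf : IsRowSymbol n f) (hs : IsRowSymbol n s) (hn : Odd n) (hn1 : 1 < n)
    (hfs : ∀ a b c, IsLevelRow n a b → IsLevelRow n a c → f a (b * c ^ 2) = f a b * s a c)
    (hp : ∀ a b c d a' b' c' d' : ℤ, a * d - b * c = 1 → a' * d' - b' * c' = 1 →
      IsLevelRow n a b → n ∣ c → n ∣ d - 1 → IsLevelRow n a' b' → n ∣ c' → n ∣ d' - 1 →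
      s (a * a' + b * c') (a * b' + b * d') = s a b * s a' b')
    {a b : ℤ} (h : IsLevelRow n a b) : f a b = 1 := by
  have hnrow : ∀ {a b}, IsLevelRow n a b → IsLevelRow n a n := fun h =>
    ⟨h.1, dvd_rfl, isCoprime_of_dvd_sub_one h.1⟩
  have hfn : ∀ {a b}, IsLevelRow n a b → f a n = 1 := fun h => hf.eq_one_of_dvd dvd_rfl h.1
  have hm : ∀ a b c, IsLevelRow n a b → IsLevelRow n a c → s a (b * c) = s a b * s a c := by
    intro a b c hb hc
    have h1 := hfs a n (b * c) (hnrow hb) (hb.mul_right hc.3)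
    have h2 := hfs a (n * b ^ 2) c ((hnrow hb).mul_right hb.3.pow_right) hc
    rw [hfs a n b (hnrow hb) hb, hfn hb, one_mul] at h2
    rw [hfn hb, one_mul] at h1
    rw [← h1, ← h2]
    congr 1; ring
  have hf2 : ∀ a b c, IsLevelRow n a b → IsLevelRow n a c → f a (b * c ^ 2) = f a b := by
    intro a b c hb hc
    rw [hfs a b c hb hc, hs.eq_one_of_mul hn hn1 hm hp hc, mul_one]
  -- reduction to odd `b`
  wlog hb : Odd b generalizing b
  · have hb' : Even b := by simpa using hb
    have ha : Odd a := by
      by_contra ha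
      have := Int.isUnit_iff.1 (h.3.isUnit_of_dvd' (Int.not_odd_iff_even.1 ha).two_dvd hb'.two_dvd)
      omega
    rw [← hf.add_right a b 1 h]
    refine this (h.add_right 1) ?_
    rw [mul_one]
    exact hb'.add_odd (hn.mul ha)
  have hb0 : b ≠ 0 := by rintro rfl; simp at hb
  -- a prime `p` congruent to `a` modulo `b` and to `3` modulo `4`
  obtain ⟨p, hp2, hpp, hpa, hp4⟩ :
      ∃ p : ℕ, 2 < p ∧ p.Prime ∧ b ∣ (p : ℤ) - a ∧ (4 : ℤ) ∣ p + 1 := by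
    have h2b : IsCoprime b 2 := (Int.isCoprime_two_left.2 hb).symm
    exact exists_prime_dvd_sub_dvd_add_one hb0 (by norm_num)
      (by simpa using h2b.pow_right (n := 2)) h.3
  rw [← hf.congr_left h hpa]
  have hrow : IsLevelRow n p b := by
    obtain ⟨k, hk⟩ := hpa
    have := h.add_left k
    rwa [show a + k * b = p by linear_combination -hk] at this
  obtain ⟨hp1, ⟨x, rfl⟩, hc⟩ := hrow
  have hx : IsCoprime (p : ℤ) x := hc.of_mul_right_right
  have hpn : IsCoprime (p : ℤ) n := hc.of_mul_right_left
  have := Fact.mk hpp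
  -- `x` is a square up to sign modulo `p`
  obtain ⟨e, y, he, hy⟩ : ∃ e y : ℤ, (e = 1 ∨ e = -1) ∧ (p : ℤ) ∣ e * y ^ 2 - x := by
    have hx0 : (x : ZMod p) ≠ 0 := by
      intro h0
      have := (ZMod.intCast_zmod_eq_zero_iff_dvd x p).1 h0
      have := Int.isUnit_iff.1 (hx.isUnit_of_dvd' dvd_rfl this)
      omega
    have key : ∀ e : ℤ, (e = 1 ∨ e = -1) → IsSquare ((e * x : ℤ) : ZMod p) →
        ∃ e y : ℤ, (e = 1 ∨ e = -1) ∧ (p : ℤ) ∣ e * y ^ 2 - x := by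
      rintro e he ⟨r, hr⟩
      refine ⟨e, r.cast, he, ?_⟩
      rw [← ZMod.intCast_zmod_eq_zero_iff_dvd]
      push_cast at hr ⊢
      rw [pow_two, ← hr]
      rcases he with rfl | rfl <;> simp
    rcases ZMod.pow_div_two_eq_neg_one_or_one p hx0 with h1 | h1
    · exact key 1 (.inl rfl) (by simpa using (ZMod.euler_criterion p hx0).2 h1)
    · refine key (-1) (.inr rfl) ?_
      have : ((-1 * x : ℤ) : ZMod p) ≠ 0 := by simpa using hx0
      rw [ZMod.euler_criterion p this]
      push_cast
      rw [mul_pow, h1, Odd.neg_one_pow]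
      · simp
      · rw [Nat.odd_iff]; omega
  -- which may be chosen divisible by `n`
  obtain ⟨z, hzp, hzn⟩ : ∃ z : ℤ, (p : ℤ) ∣ z - y ∧ n ∣ z := by
    obtain ⟨u, v, huv⟩ := hpn
    exact ⟨y * (v * n), ⟨-u * y, by linear_combination y * huv⟩, ⟨y * v, by ring⟩⟩
  have hez : (p : ℤ) ∣ e * z ^ 2 - x := by
    exact (dvd_add (hzp.mul_right (e * (z + y))) hy).trans (dvd_of_eq (by ring))
  have hzc : IsCoprime (p : ℤ) z := by
    obtain ⟨k, hk⟩ := hez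
    have h1 : IsCoprime (p : ℤ) (e * z ^ 2) := by
      rw [show e * z ^ 2 = x + p * k by linear_combination hk]
      exact hx.add_mul_left_right k
    exact h1.of_mul_right_right.of_isCoprime_of_dvd_right (dvd_pow_self z two_ne_zero)
  have hpe : IsCoprime (p : ℤ) e := by
    rcases he with rfl | rfl
    · exact isCoprime_one_right
    · exact isCoprime_one_right.neg_right
  rw [← hf.congr_right hp1 hx hez, ← mul_assoc,
    hf2 _ _ _ (.of_mul hp1 hpe) ⟨hp1, hzn, hzc⟩]
  rcases he with rfl | rfl <;> exact hf.eq_one_of_dvd (by simp) (by simpa using hp1)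

end IsRowSymbol

namespace SymplecticGroup

open scoped MatrixGroups commutatorElement

section Embedding

variable {k l m : Type*} [DecidableEq l]

/-- The matrix restricting vectors along `φ` on both halves of the coordinates. -/
def restr (φ : m → l) : Matrix (m ⊕ m) (l ⊕ l) ℤ :=
  (1 : Matrix (l ⊕ l) (l ⊕ l) ℤ).submatrix (Sum.map φ φ) id

variable [Fintype l]

theorem restr_mulVec (φ : m → l) (v : l ⊕ l → ℤ) : restr φ *ᵥ v = v ∘ Sum.map φ φ := by
  ext x
  simp [restr, Matrix.mulVec, dotProduct, Matrix.one_apply]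

theorem restr_mul {o : Type*} (φ : m → l) (A : Matrix (l ⊕ l) o ℤ) :
    restr φ * A = A.submatrix (Sum.map φ φ) id := by
  ext x y
  simp [restr, Matrix.mul_apply, Matrix.one_apply]

theorem restr_mul_transpose_of_disjoint {φ : m → l} {ψ : k → l} (h : ∀ x y, φ x ≠ ψ y) :
    restr φ * (restr ψ)ᵀ = 0 := by
  rw [restr_mul]
  ext x y
  rcases x with x | x <;> rcases y with y | y <;>
    simp [restr, Matrix.one_apply, h]

theorem restr_mul_restr {o : Type*} [DecidableEq o] (ψ : l → o) (φ : m → l) :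
    restr φ * restr ψ = restr (ψ ∘ φ) := by
  rw [restr_mul]
  ext x y
  rcases x with x | x <;> rcases y with y | y <;> rfl

variable [DecidableEq m] [DecidableEq k]

theorem restr_mul_transpose (φ : m ↪ l) : restr φ * (restr φ)ᵀ = 1 := by
  rw [restr_mul]
  ext x y
  simp only [restr, Matrix.submatrix_apply, Matrix.transpose_apply, id, Matrix.one_apply,
    (Function.Injective.sumMap φ.injective φ.injective).eq_iff, eq_comm]

variable [Fintype m] [Fintype k]

theorem restr_mul_J (φ : m ↪ l) : restr φ * J l ℤ = J m ℤ * restr φ := by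
  have h : restr φ = fromBlocks ((1 : Matrix l l ℤ).submatrix φ id) 0 0
      ((1 : Matrix l l ℤ).submatrix φ id) := by
    ext x y
    rcases x with x | x <;> rcases y with y | y <;> simp [restr, Matrix.one_apply]
  rw [h, J, J, fromBlocks_multiply, fromBlocks_multiply]
  simp

theorem transpose_restr_mul_J (φ : m ↪ l) : (restr φ)ᵀ * J m ℤ = J l ℤ * (restr φ)ᵀ := by
  have := congrArg transpose (restr_mul_J φ)
  simpa [Matrix.transpose_mul] using this.symm

/-- The matrix acting as `M` on the coordinates in the range of `φ` and trivially on the others. -/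
def embMatrix (φ : m → l) (M : Matrix (m ⊕ m) (m ⊕ m) ℤ) : Matrix (l ⊕ l) (l ⊕ l) ℤ :=
  1 + (restr φ)ᵀ * (M - 1) * restr φ

theorem restr_mul_embMatrix (φ : m ↪ l) (M : Matrix (m ⊕ m) (m ⊕ m) ℤ) :
    restr φ * embMatrix φ M = M * restr φ := by
  simp only [embMatrix, Matrix.mul_add, ← Matrix.mul_assoc, restr_mul_transpose, Matrix.one_mul,
    Matrix.mul_one, Matrix.sub_mul]
  abel

theorem embMatrix_mul (φ : m ↪ l) (M M' : Matrix (m ⊕ m) (m ⊕ m) ℤ) :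
    embMatrix φ (M * M') = embMatrix φ M * embMatrix φ M' := by
  conv_rhs => rw [embMatrix, Matrix.add_mul, Matrix.mul_assoc, restr_mul_embMatrix]
  simp only [embMatrix, Matrix.one_mul, Matrix.mul_sub, Matrix.sub_mul, Matrix.mul_one,
    Matrix.mul_assoc]
  abel

theorem embMatrix_mem (φ : m ↪ l) {M : Matrix (m ⊕ m) (m ⊕ m) ℤ} (hM : M ∈ symplecticGroup m ℤ) :
    embMatrix φ M ∈ symplecticGroup l ℤ := by
  rw [SymplecticGroup.mem_iff] at hM ⊢
  set P := restr φ with hP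
  have h1 : P * J l ℤ = J m ℤ * P := restr_mul_J φ
  have h2 : P * Pᵀ = 1 := restr_mul_transpose φ
  have h3 : Pᵀ * J m ℤ = J l ℤ * Pᵀ := transpose_restr_mul_J φ
  have h4 : (embMatrix φ M)ᵀ = 1 + Pᵀ * (Mᵀ - 1) * P := by
    simp [embMatrix, Matrix.transpose_mul, Matrix.mul_assoc, ← hP]
  have h5 : P * (embMatrix φ M)ᵀ = Mᵀ * P := by
    rw [h4]
    simp only [Matrix.mul_add, ← Matrix.mul_assoc, h2, Matrix.one_mul, Matrix.mul_one,
      Matrix.sub_mul]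
    abel
  have h6 : embMatrix φ M * J l ℤ * (embMatrix φ M)ᵀ
      = J l ℤ * (embMatrix φ M)ᵀ + Pᵀ * (M - 1) * J m ℤ * Mᵀ * P := by
    have e : embMatrix φ M = 1 + Pᵀ * (M - 1) * P := rfl
    nth_rewrite 1 [e]
    rw [Matrix.add_mul, Matrix.add_mul]
    rw [Matrix.one_mul, Matrix.mul_assoc _ P, h1, ← Matrix.mul_assoc, Matrix.mul_assoc _ P, h5]
    simp only [Matrix.mul_assoc]
  rw [h6, h4, Matrix.mul_add, ← Matrix.mul_assoc, ← Matrix.mul_assoc, ← h3, Matrix.mul_one,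
    Matrix.mul_sub Pᵀ, Matrix.sub_mul, Matrix.sub_mul, Matrix.sub_mul, Matrix.mul_assoc Pᵀ M,
    Matrix.mul_assoc Pᵀ _ Mᵀ, hM]
  simp only [Matrix.mul_sub, Matrix.sub_mul, Matrix.mul_one]
  abel

/-- The embedding `Sp(m) → Sp(l)` induced by an embedding `m ↪ l` of index types. -/
def emb (φ : m ↪ l) : symplecticGroup m ℤ →* symplecticGroup l ℤ where
  toFun M := ⟨embMatrix φ M, embMatrix_mem φ M.2⟩
  map_one' := Subtype.ext (by simp [embMatrix])
  map_mul' M M' := Subtype.ext (embMatrix_mul φ M M')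

theorem coe_emb (φ : m ↪ l) (M : symplecticGroup m ℤ) :
    (emb φ M : Matrix (l ⊕ l) (l ⊕ l) ℤ) = embMatrix φ M := rfl

theorem emb_mulVec (φ : m ↪ l) (M : symplecticGroup m ℤ) (v : l ⊕ l → ℤ) :
    (emb φ M).1 *ᵥ v = v + (restr φ)ᵀ *ᵥ (M.1 *ᵥ (v ∘ Sum.map φ φ) - v ∘ Sum.map φ φ) := by
  simp only [coe_emb, embMatrix, Matrix.add_mulVec, Matrix.one_mulVec, Matrix.mul_assoc,
    ← Matrix.mulVec_mulVec, restr_mulVec, Matrix.sub_mulVec]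

theorem emb_mulVec_comp (φ : m ↪ l) (M : symplecticGroup m ℤ) (v : l ⊕ l → ℤ) :
    ((emb φ M).1 *ᵥ v) ∘ Sum.map φ φ = M.1 *ᵥ (v ∘ Sum.map φ φ) := by
  rw [← restr_mulVec, Matrix.mulVec_mulVec, coe_emb, restr_mul_embMatrix, ← Matrix.mulVec_mulVec,
    restr_mulVec]

theorem emb_emb (φ : m ↪ l) (ψ : k ↪ m) (M : symplecticGroup k ℤ) :
    emb φ (emb ψ M) = emb (ψ.trans φ) M := by
  apply Subtype.ext
  simp only [coe_emb, embMatrix, Function.Embedding.coe_trans, ← restr_mul_restr,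
    Matrix.transpose_mul, Matrix.mul_assoc, add_sub_cancel_left]

theorem emb_commute (φ : m ↪ l) (ψ : k ↪ l) (h : ∀ x y, φ x ≠ ψ y) (M : symplecticGroup m ℤ)
    (M' : symplecticGroup k ℤ) : Commute (emb φ M) (emb ψ M') := by
  apply Subtype.ext
  have h1 : restr φ * (restr ψ)ᵀ = 0 := restr_mul_transpose_of_disjoint h
  have h2 : restr ψ * (restr φ)ᵀ = 0 := restr_mul_transpose_of_disjoint fun x y => (h y x).symm
  have e1 : restr φ * embMatrix ψ M'.1 = restr φ := by
    rw [embMatrix, Matrix.mul_add, ← Matrix.mul_assoc, ← Matrix.mul_assoc, h1]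
    simp
  have e2 : restr ψ * embMatrix φ M.1 = restr ψ := by
    rw [embMatrix, Matrix.mul_add, ← Matrix.mul_assoc, ← Matrix.mul_assoc, h2]
    simp
  change embMatrix φ M.1 * embMatrix ψ M'.1 = embMatrix ψ M'.1 * embMatrix φ M.1
  conv_lhs => rw [embMatrix, Matrix.add_mul, Matrix.mul_assoc, e1]
  conv_rhs => rw [embMatrix, Matrix.add_mul, Matrix.mul_assoc, e2]
  simp only [embMatrix, Matrix.one_mul]
  abel

end Embedding

section Local

variable {l m : Type*} [DecidableEq l] [Fintype l] [DecidableEq m] [Fintype m]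

/-- The subgroup of symplectic matrices acting trivially on the coordinates outside `S`. -/
def localSubgroup (S : Set l) : Subgroup (symplecticGroup l ℤ) where
  carrier := {γ | ∀ v : l ⊕ l → ℤ, (∀ i ∈ S, v (.inl i) = 0 ∧ v (.inr i) = 0) → γ.1 *ᵥ v = v}
  one_mem' := by simp
  mul_mem' {γ δ} hγ hδ v hv := by
    rw [Submonoid.coe_mul, ← Matrix.mulVec_mulVec, hδ v hv, hγ v hv]
  inv_mem' {γ} hγ v hv := by
    conv_lhs => rw [← hγ v hv]
    rw [Matrix.mulVec_mulVec, ← Submonoid.coe_mul, inv_mul_cancel]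
    simp

theorem localSubgroup_mono {S T : Set l} (h : S ⊆ T) :
    localSubgroup S ≤ localSubgroup T := fun _ hγ v hv => hγ v fun i hi => hv i (h hi)

theorem dotProduct_J_mulVec (γ : symplecticGroup l ℤ) (u v : l ⊕ l → ℤ) :
    (γ.1 *ᵥ u) ⬝ᵥ (J l ℤ *ᵥ (γ.1 *ᵥ v)) = u ⬝ᵥ (J l ℤ *ᵥ v) := by
  conv_rhs => rw [← SymplecticGroup.mem_iff'.1 γ.2]
  rw [← Matrix.mulVec_mulVec, ← Matrix.mulVec_mulVec, Matrix.dotProduct_mulVec u,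
    Matrix.vecMul_transpose]

theorem J_mulVec_inl (v : l ⊕ l → ℤ) (i : l) : (J l ℤ *ᵥ v) (.inl i) = -v (.inr i) := by
  simp [J, Matrix.mulVec, dotProduct, Matrix.one_apply, Matrix.neg_apply]

theorem J_mulVec_inr (v : l ⊕ l → ℤ) (i : l) : (J l ℤ *ᵥ v) (.inr i) = v (.inl i) := by
  simp [J, Matrix.mulVec, dotProduct, Matrix.one_apply]

theorem mulVec_inl_of_mem {S : Set l} {γ : symplecticGroup l ℤ} (hγ : γ ∈ localSubgroup S)
    (v : l ⊕ l → ℤ) {i : l} (hi : i ∉ S) : (γ.1 *ᵥ v) (.inl i) = v (.inl i) := by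
  have h1 := dotProduct_J_mulVec γ (Pi.single (.inr i) 1) v
  rw [hγ (Pi.single (.inr i) 1)] at h1
  · simpa only [single_dotProduct, one_mul, J_mulVec_inr, neg_inj] using h1
  · intro j hj
    have : j ≠ i := fun h => hi (h ▸ hj)
    simp [this]

theorem mulVec_inr_of_mem {S : Set l} {γ : symplecticGroup l ℤ} (hγ : γ ∈ localSubgroup S)
    (v : l ⊕ l → ℤ) {i : l} (hi : i ∉ S) : (γ.1 *ᵥ v) (.inr i) = v (.inr i) := by
  have h1 := dotProduct_J_mulVec γ (Pi.single (.inl i) 1) v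
  rw [hγ (Pi.single (.inl i) 1)] at h1
  · simpa only [single_dotProduct, one_mul, J_mulVec_inl, neg_inj] using h1
  · intro j hj
    have : j ≠ i := fun h => hi (h ▸ hj)
    simp [this]

theorem emb_mem_localSubgroup (φ : m ↪ l) (M : symplecticGroup m ℤ) {S : Set l}
    (h : ∀ x, φ x ∈ S) : emb φ M ∈ localSubgroup S := by
  intro v hv
  have : v ∘ Sum.map φ φ = 0 := by
    ext x
    rcases x with x | x
    · exact (hv _ (h x)).1
    · exact (hv _ (h x)).2
  simp [emb_mulVec, this]

/-- A symplectic matrix supported on the range of `φ` is in the image of `emb φ`. -/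
theorem exists_emb_eq (φ : m ↪ l) {γ : symplecticGroup l ℤ}
    (hγ : γ ∈ localSubgroup (Set.range φ)) : ∃ M, emb φ M = γ := by
  set P := restr φ with hP
  have h2 : P * Pᵀ = 1 := restr_mul_transpose φ
  have fix : ∀ δ ∈ localSubgroup (Set.range φ), (δ.1 - 1) * (1 - Pᵀ * P) = 0 := by
    intro δ hδ
    refine Matrix.ext_of_mulVec_single fun x => ?_
    rw [← Matrix.mulVec_mulVec, Matrix.sub_mulVec, hδ]
    · rw [Matrix.one_mulVec, sub_self, Matrix.zero_mulVec]
    · have : P *ᵥ ((1 - Pᵀ * P) *ᵥ Pi.single x 1) = 0 := by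
        rw [Matrix.mulVec_mulVec, Matrix.mul_sub, ← Matrix.mul_assoc, h2,
          Matrix.one_mul, Matrix.mul_one, sub_self, Matrix.zero_mulVec]
      rw [restr_mulVec] at this
      rintro _ ⟨y, rfl⟩
      exact ⟨congrFun this (.inl y), congrFun this (.inr y)⟩
  have hl := fix γ hγ
  have hr : (1 - Pᵀ * P) * (γ.1 - 1) = 0 := by
    have h := fix γ⁻¹ (inv_mem hγ)
    have hJ : J l ℤ * J l ℤ = -1 := J_squared l ℤ
    have hQ : J l ℤ * (Pᵀ * P) = (Pᵀ * P) * J l ℤ := by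
      rw [Matrix.mul_assoc, restr_mul_J, ← Matrix.mul_assoc, ← Matrix.mul_assoc,
        transpose_restr_mul_J]
    have h3 : (J l ℤ * (γ.1ᵀ - 1)) * (1 - Pᵀ * P) = 0 := by
      have e : (γ⁻¹.1 - 1) = - (J l ℤ * (γ.1ᵀ - 1) * J l ℤ) := by
        rw [SymplecticGroup.coe_inv]
        simp only [Matrix.mul_sub, Matrix.sub_mul, Matrix.mul_one, hJ, Matrix.neg_mul]
        abel
      have h4 : (1 - Pᵀ * P) * J l ℤ = J l ℤ * (1 - Pᵀ * P) := by
        rw [Matrix.sub_mul, Matrix.mul_sub, hQ, Matrix.one_mul, Matrix.mul_one]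
      have h5 := congrArg (· * J l ℤ) h
      simp only [e, Matrix.neg_mul, Matrix.zero_mul] at h5
      rw [Matrix.mul_assoc _ (1 - Pᵀ * P), h4, Matrix.mul_assoc _ (J l ℤ),
        ← Matrix.mul_assoc (J l ℤ) (J l ℤ), hJ] at h5
      rwa [Matrix.neg_mul, Matrix.one_mul, Matrix.mul_neg, neg_neg] at h5
    have h6 := congrArg (J l ℤ * ·) h3
    simp only [← Matrix.mul_assoc, hJ, Matrix.mul_zero, Matrix.neg_mul, Matrix.one_mul,
      neg_eq_zero] at h6
    have h7 := congrArg transpose h6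
    simpa only [Matrix.transpose_mul, Matrix.transpose_sub, Matrix.transpose_one,
      Matrix.transpose_transpose, Matrix.transpose_zero] using h7
  set B := P * γ.1 * Pᵀ with hB
  have hγB : γ.1 = embMatrix φ B := by
    have h3 : Pᵀ * (B - 1) * P = (Pᵀ * P) * (γ.1 - 1) * (Pᵀ * P) := by
      have : B - 1 = P * (γ.1 - 1) * Pᵀ := by
        rw [Matrix.mul_sub, Matrix.sub_mul, Matrix.mul_one, h2]
      rw [this]
      simp only [Matrix.mul_assoc]
    rw [Matrix.sub_mul, Matrix.one_mul, sub_eq_zero] at hr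
    rw [Matrix.mul_sub, Matrix.mul_one, sub_eq_zero] at hl
    rw [embMatrix, ← hP, h3, ← hr, ← hl]
    abel
  have hPB : restr φ * γ.1 = B * restr φ := by rw [hγB, restr_mul_embMatrix]
  have hmem : B ∈ symplecticGroup m ℤ := by
    rw [SymplecticGroup.mem_iff]
    have h1 := SymplecticGroup.mem_iff.1 γ.2
    have h5 : restr φ * (γ.1 * J l ℤ * γ.1ᵀ) * (restr φ)ᵀ = J m ℤ := by
      rw [h1, restr_mul_J, Matrix.mul_assoc, restr_mul_transpose, Matrix.mul_one]
    have h3 : γ.1ᵀ * (restr φ)ᵀ = (restr φ)ᵀ * Bᵀ := by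
      rw [← Matrix.transpose_mul, hPB, Matrix.transpose_mul]
    calc B * J m ℤ * Bᵀ = B * (J m ℤ * (P * Pᵀ)) * Bᵀ := by rw [h2, Matrix.mul_one]
      _ = B * (P * J l ℤ) * (Pᵀ * Bᵀ) := by rw [hP, restr_mul_J]; simp only [Matrix.mul_assoc]
      _ = (P * γ.1) * J l ℤ * (γ.1ᵀ * Pᵀ) := by rw [h3, hPB]; simp only [Matrix.mul_assoc, hP]
      _ = J m ℤ := by rw [← h5]; simp only [Matrix.mul_assoc, hP]
  exact ⟨⟨B, hmem⟩, Subtype.ext hγB.symm⟩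

end Local

section Action

variable {l m : Type*} [DecidableEq l] [Fintype l] [DecidableEq m] [Fintype m]

/-- The action of a symplectic matrix on column vectors. -/
def act (γ : symplecticGroup l ℤ) (v : l ⊕ l → ℤ) : l ⊕ l → ℤ := γ.1 *ᵥ v

theorem act_one (v : l ⊕ l → ℤ) : act 1 v = v := Matrix.one_mulVec v

theorem act_mul (γ δ : symplecticGroup l ℤ) (v : l ⊕ l → ℤ) :
    act (γ * δ) v = act γ (act δ v) := (Matrix.mulVec_mulVec v γ.1 δ.1).symm

theorem act_inv_act (γ : symplecticGroup l ℤ) (v : l ⊕ l → ℤ) : act γ⁻¹ (act γ v) = v := by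
  rw [← act_mul, inv_mul_cancel, act_one]

theorem ext_act {γ δ : symplecticGroup l ℤ} (h : ∀ v, act γ v = act δ v) : γ = δ :=
  Subtype.ext (Matrix.ext_of_mulVec_single fun _ => h _)

theorem SL_mul (A B : SL(2, ℤ)) : (A * B) 0 0 = A 0 0 * B 0 0 + A 0 1 * B 1 0 ∧
    (A * B) 0 1 = A 0 0 * B 0 1 + A 0 1 * B 1 1 ∧ (A * B) 1 0 = A 1 0 * B 0 0 + A 1 1 * B 1 0 ∧
    (A * B) 1 1 = A 1 0 * B 0 1 + A 1 1 * B 1 1 := by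
  refine ⟨?_, ?_, ?_, ?_⟩ <;> exact (Matrix.mul_apply).trans (Fin.sum_univ_two _)

theorem SL_inv (A : SL(2, ℤ)) : A⁻¹ 0 0 = A 1 1 ∧ A⁻¹ 0 1 = -A 0 1 ∧ A⁻¹ 1 0 = -A 1 0 ∧
    A⁻¹ 1 1 = A 0 0 := by
  refine ⟨?_, ?_, ?_, ?_⟩ <;> exact congrFun (congrFun (Matrix.adjugate_fin_two A.1) _) _

theorem SL_det (A : SL(2, ℤ)) : A 0 0 * A 1 1 - A 0 1 * A 1 0 = 1 :=
  (Matrix.det_fin_two A.1).symm.trans A.2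

theorem SL_ext {A B : SL(2, ℤ)} (h₁ : A 0 0 = B 0 0) (h₂ : A 0 1 = B 0 1) (h₃ : A 1 0 = B 1 0)
    (h₄ : A 1 1 = B 1 1) : A = B := by
  ext i j; fin_cases i <;> fin_cases j <;> assumption

/-- The matrix in `SL₂` with the given entries. -/
def SLmk (a b c d : ℤ) (h : a * d - b * c = 1) : SL(2, ℤ) :=
  ⟨!![a, b; c, d], by rw [Matrix.det_fin_two]; exact h⟩

@[simp] theorem SLmk_apply (a b c d : ℤ) (h : a * d - b * c = 1) : SLmk a b c d h 0 0 = a ∧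
    SLmk a b c d h 0 1 = b ∧ SLmk a b c d h 1 0 = c ∧ SLmk a b c d h 1 1 = d :=
  ⟨rfl, rfl, rfl, rfl⟩

/-- The bijection of indices underlying `SL₂ ≅ Sp₂`. -/
def ofSLIndex : Unit ⊕ Unit → Fin 2 := Sum.elim (fun _ => 0) fun _ => 1

/-- The isomorphism `SL₂ ≅ Sp₂`. -/
def ofSL : SL(2, ℤ) →* symplecticGroup Unit ℤ where
  toFun M := ⟨M.1.submatrix ofSLIndex ofSLIndex, by
    have h := M.2
    rw [Matrix.det_fin_two] at h
    rw [SymplecticGroup.mem_iff]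
    ext x y
    rcases x with x | x <;> rcases y with y | y <;>
      simp [Matrix.mul_apply, J, ofSLIndex] <;> linarith⟩
  map_one' := Subtype.ext (by
    ext x y
    rcases x with x | x <;> rcases y with y | y <;> simp [ofSLIndex, Matrix.one_apply])
  map_mul' M M' := Subtype.ext (by
    obtain ⟨h₁, h₂, h₃, h₄⟩ := SL_mul M M'
    ext x y
    rcases x with x | x <;> rcases y with y | y <;> simp_all [Matrix.mul_apply, ofSLIndex])

theorem exists_ofSL_eq (γ : symplecticGroup Unit ℤ) : ∃ M, ofSL M = γ := by
  have h := SymplecticGroup.mem_iff.1 γ.2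
  have h1 := congrFun (congrFun h (.inr ())) (.inl ())
  simp [Matrix.mul_apply, J] at h1
  refine ⟨SLmk (γ.1 (.inl ()) (.inl ())) (γ.1 (.inl ()) (.inr ()))
    (γ.1 (.inr ()) (.inl ())) (γ.1 (.inr ()) (.inr ())) (by linarith), Subtype.ext ?_⟩
  ext x y
  rcases x with x | x <;> rcases y with y | y <;> rfl

/-- The copy of `SL₂` acting on the two coordinates with index `i`. -/
def long (i : l) : SL(2, ℤ) →* symplecticGroup l ℤ :=
  (emb ⟨fun _ : Unit => i, fun _ _ _ => rfl⟩).comp ofSL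

theorem emb_long (φ : m ↪ l) (i : m) (M : SL(2, ℤ)) : emb φ (long i M) = long (φ i) M :=
  emb_emb _ _ _

theorem long_mem_localSubgroup (i : l) (M : SL(2, ℤ)) {S : Set l} (h : i ∈ S) :
    long i M ∈ localSubgroup S := emb_mem_localSubgroup _ _ fun _ => h

theorem act_long_inl (i : l) (M : SL(2, ℤ)) (v : l ⊕ l → ℤ) :
    act (long i M) v (.inl i) = M 0 0 * v (.inl i) + M 0 1 * v (.inr i) := by
  have := congrFun (emb_mulVec_comp ⟨fun _ : Unit => i, fun _ _ _ => rfl⟩ (ofSL M) v) (.inl ())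
  refine this.trans ?_
  simp [Matrix.mulVec, dotProduct, ofSL, ofSLIndex]
  rfl

theorem act_long_inr (i : l) (M : SL(2, ℤ)) (v : l ⊕ l → ℤ) :
    act (long i M) v (.inr i) = M 1 0 * v (.inl i) + M 1 1 * v (.inr i) := by
  have := congrFun (emb_mulVec_comp ⟨fun _ : Unit => i, fun _ _ _ => rfl⟩ (ofSL M) v) (.inr ())
  refine this.trans ?_
  simp [Matrix.mulVec, dotProduct, ofSL, ofSLIndex]
  rfl

theorem act_long_inl_of_ne {i j : l} (h : j ≠ i) (M : SL(2, ℤ)) (v : l ⊕ l → ℤ) :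
    act (long i M) v (.inl j) = v (.inl j) :=
  mulVec_inl_of_mem (long_mem_localSubgroup i M (Set.mem_singleton i)) v h

theorem act_long_inr_of_ne {i j : l} (h : j ≠ i) (M : SL(2, ℤ)) (v : l ⊕ l → ℤ) :
    act (long i M) v (.inr j) = v (.inr j) :=
  mulVec_inr_of_mem (long_mem_localSubgroup i M (Set.mem_singleton i)) v h

/-- The Levi embedding `A ↦ diag(A, A⁻ᵀ)` of the special linear group. -/
def levi : SpecialLinearGroup l ℤ →* symplecticGroup l ℤ where
  toFun A := ⟨fromBlocks A.1 0 0 (A⁻¹).1ᵀ, by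
    have h : A.1 * (A⁻¹).1 = 1 := congrArg Subtype.val (mul_inv_cancel A)
    have h' : (A⁻¹).1ᵀ * A.1ᵀ = 1 := by rw [← Matrix.transpose_mul, h, Matrix.transpose_one]
    rw [SymplecticGroup.mem_iff, J, fromBlocks_transpose, fromBlocks_multiply,
      fromBlocks_multiply]
    simp only [Matrix.mul_zero, Matrix.zero_mul, Matrix.mul_one, Matrix.mul_neg, Matrix.neg_mul,
      Matrix.transpose_transpose, Matrix.transpose_zero, h, h', add_zero, zero_add, neg_zero]⟩
  map_one' := Subtype.ext (by simp)
  map_mul' A B := Subtype.ext (by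
    change fromBlocks (A.1 * B.1) 0 0 ((A * B)⁻¹).1ᵀ = fromBlocks _ _ _ _ * fromBlocks _ _ _ _
    have h : ((A * B)⁻¹).1 = (B⁻¹).1 * (A⁻¹).1 := congrArg Subtype.val (_root_.mul_inv_rev A B)
    rw [fromBlocks_multiply, h, Matrix.transpose_mul]
    simp)

end Action

section Rank

/-- The vector of length four with the given coordinates. -/
def vec (a₁ a₂ b₁ b₂ : ℤ) : Fin 2 ⊕ Fin 2 → ℤ := Sum.elim ![a₁, a₂] ![b₁, b₂]

theorem eq_vec (v : Fin 2 ⊕ Fin 2 → ℤ) :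
    v = vec (v (.inl 0)) (v (.inl 1)) (v (.inr 0)) (v (.inr 1)) := by
  ext x
  rcases x with x | x <;> fin_cases x <;> rfl

theorem vec_congr {a₁ a₂ b₁ b₂ a₁' a₂' b₁' b₂' : ℤ} (h₁ : a₁ = a₁') (h₂ : a₂ = a₂')
    (h₃ : b₁ = b₁') (h₄ : b₂ = b₂') : vec a₁ a₂ b₁ b₂ = vec a₁' a₂' b₁' b₂' := by
  rw [h₁, h₂, h₃, h₄]

theorem ext_vec {γ δ : symplecticGroup (Fin 2) ℤ}
    (h : ∀ a₁ a₂ b₁ b₂, act γ (vec a₁ a₂ b₁ b₂) = act δ (vec a₁ a₂ b₁ b₂)) : γ = δ :=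
  ext_act fun v => by rw [eq_vec v]; exact h _ _ _ _

theorem act_long_zero (M : SL(2, ℤ)) (a₁ a₂ b₁ b₂ : ℤ) : act (long 0 M) (vec a₁ a₂ b₁ b₂) =
    vec (M 0 0 * a₁ + M 0 1 * b₁) a₂ (M 1 0 * a₁ + M 1 1 * b₁) b₂ := by
  rw [eq_vec (act _ _), act_long_inl, act_long_inr, act_long_inl_of_ne (by decide),
    act_long_inr_of_ne (by decide)]
  rfl

theorem act_long_one (M : SL(2, ℤ)) (a₁ a₂ b₁ b₂ : ℤ) : act (long 1 M) (vec a₁ a₂ b₁ b₂) =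
    vec a₁ (M 0 0 * a₂ + M 0 1 * b₂) b₁ (M 1 0 * a₂ + M 1 1 * b₂) := by
  rw [eq_vec (act _ _), act_long_inl, act_long_inr, act_long_inl_of_ne (by decide),
    act_long_inr_of_ne (by decide)]
  rfl

theorem act_levi (M : SL(2, ℤ)) (a₁ a₂ b₁ b₂ : ℤ) : act (levi M) (vec a₁ a₂ b₁ b₂) =
    vec (M 0 0 * a₁ + M 0 1 * a₂) (M 1 0 * a₁ + M 1 1 * a₂)
      (M 1 1 * b₁ - M 1 0 * b₂) (-M 0 1 * b₁ + M 0 0 * b₂) := by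
  rw [eq_vec (act _ _)]
  apply vec_congr <;>
  simp [act, levi, Matrix.mulVec, dotProduct, vec, Matrix.adjugate_fin_two, sub_eq_add_neg]

/-- Upper unitriangular matrices. -/
def upper (t : ℤ) : SL(2, ℤ) := SLmk 1 t 0 1 (by ring)

/-- Lower unitriangular matrices. -/
def lower (t : ℤ) : SL(2, ℤ) := SLmk 1 0 t 1 (by ring)

/-- The Weyl element of `SL₂`. -/
def weyl : SL(2, ℤ) := SLmk 0 1 (-1) 0 (by ring)

@[simp] theorem upper_apply (t : ℤ) : upper t 0 0 = 1 ∧ upper t 0 1 = t ∧ upper t 1 0 = 0 ∧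
    upper t 1 1 = 1 := ⟨rfl, rfl, rfl, rfl⟩

@[simp] theorem lower_apply (t : ℤ) : lower t 0 0 = 1 ∧ lower t 0 1 = 0 ∧ lower t 1 0 = t ∧
    lower t 1 1 = 1 := ⟨rfl, rfl, rfl, rfl⟩

@[simp] theorem weyl_apply : weyl 0 0 = 0 ∧ weyl 0 1 = 1 ∧ weyl 1 0 = -1 ∧
    weyl 1 1 = 0 := ⟨rfl, rfl, rfl, rfl⟩

theorem upper_add (s t : ℤ) : upper (s + t) = upper s * upper t := by
  apply SL_ext <;> simp only [SL_mul, upper_apply] <;> ring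

theorem weyl_conj_upper (t : ℤ) : weyl * upper t * weyl⁻¹ = lower (-t) := by
  apply SL_ext <;> simp only [SL_mul, SL_inv, upper_apply, lower_apply, weyl_apply] <;> ring

/-- The root element acting by `a₁ += t * b₂`, `a₂ += t * b₁`. -/
def shortUpper (t : ℤ) : symplecticGroup (Fin 2) ℤ :=
  long 1 weyl * levi (upper (-t)) * (long 1 weyl)⁻¹

/-- The root element acting by `b₁ += t * a₂`, `b₂ += t * a₁`. -/
def shortLower (t : ℤ) : symplecticGroup (Fin 2) ℤ :=
  long 1 weyl * levi (lower (-t)) * (long 1 weyl)⁻¹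

theorem act_shortUpper (t a₁ a₂ b₁ b₂ : ℤ) : act (shortUpper t) (vec a₁ a₂ b₁ b₂) =
    vec (a₁ + t * b₂) (a₂ + t * b₁) b₁ b₂ := by
  rw [shortUpper, ← map_inv, act_mul, act_mul, act_long_one, act_levi, act_long_one]
  apply vec_congr <;> simp only [SL_inv, upper_apply, weyl_apply] <;> ring

theorem act_shortLower (t a₁ a₂ b₁ b₂ : ℤ) : act (shortLower t) (vec a₁ a₂ b₁ b₂) =
    vec a₁ a₂ (b₁ + t * a₂) (b₂ + t * a₁) := by
  rw [shortLower, ← map_inv, act_mul, act_mul, act_long_one, act_levi, act_long_one]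
  apply vec_congr <;> simp only [SL_inv, lower_apply, weyl_apply] <;> ring

theorem act_levi_upper (t a₁ a₂ b₁ b₂ : ℤ) : act (levi (upper t)) (vec a₁ a₂ b₁ b₂) =
    vec (a₁ + t * a₂) a₂ b₁ (b₂ - t * b₁) := by
  rw [act_levi]
  apply vec_congr <;> simp only [upper_apply] <;> ring

theorem act_levi_lower (t a₁ a₂ b₁ b₂ : ℤ) : act (levi (lower t)) (vec a₁ a₂ b₁ b₂) =
    vec a₁ (a₂ + t * a₁) (b₁ - t * b₂) b₂ := by
  rw [act_levi]
  apply vec_congr <;> simp only [lower_apply] <;> ring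

theorem act_long_zero_upper (t a₁ a₂ b₁ b₂ : ℤ) : act (long 0 (upper t)) (vec a₁ a₂ b₁ b₂) =
    vec (a₁ + t * b₁) a₂ b₁ b₂ := by
  rw [act_long_zero]
  apply vec_congr <;> simp only [upper_apply] <;> ring

theorem act_long_zero_lower (t a₁ a₂ b₁ b₂ : ℤ) : act (long 0 (lower t)) (vec a₁ a₂ b₁ b₂) =
    vec a₁ a₂ (b₁ + t * a₁) b₂ := by
  rw [act_long_zero]
  apply vec_congr <;> simp only [lower_apply] <;> ring

theorem act_long_one_upper (t a₁ a₂ b₁ b₂ : ℤ) : act (long 1 (upper t)) (vec a₁ a₂ b₁ b₂) =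
    vec a₁ (a₂ + t * b₂) b₁ b₂ := by
  rw [act_long_one]
  apply vec_congr <;> simp only [upper_apply] <;> ring

end Rank

section Pair

variable {l : Type*}

/-- The embedding of `Fin 2` with the given two distinct values. -/
def pair (i j : l) (h : i ≠ j) : Fin 2 ↪ l :=
  ⟨![i, j], by intro x y; fin_cases x <;> fin_cases y <;> simp [h, h.symm]⟩

@[simp] theorem pair_zero (i j : l) (h : i ≠ j) : pair i j h 0 = i := rfl

@[simp] theorem pair_one (i j : l) (h : i ≠ j) : pair i j h 1 = j := rfl

theorem eq_pair (φ : Fin 2 ↪ l) : φ = pair (φ 0) (φ 1) (φ.injective.ne (by decide)) := by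
  ext x; fin_cases x <;> rfl

theorem transpose_restr_mulVec_vec [DecidableEq l] (φ : Fin 2 ↪ l) (a₁ a₂ b₁ b₂ : ℤ) :
    (restr φ)ᵀ *ᵥ vec a₁ a₂ b₁ b₂ = Pi.single (.inl (φ 0)) a₁ + Pi.single (.inl (φ 1)) a₂ +
      Pi.single (.inr (φ 0)) b₁ + Pi.single (.inr (φ 1)) b₂ := by
  ext x
  rcases x with x | x <;>
    simp [Matrix.mulVec, dotProduct, restr, vec, Matrix.one_apply, Pi.single_apply, eq_comm]

end Pair

section Congruence

variable {l m : Type*} [DecidableEq l] [Fintype l] [DecidableEq m] [Fintype m] {n : ℤ}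

theorem act_add (γ : symplecticGroup l ℤ) (v w : l ⊕ l → ℤ) :
    act γ (v + w) = act γ v + act γ w := Matrix.mulVec_add _ _ _

theorem act_sub (γ : symplecticGroup l ℤ) (v w : l ⊕ l → ℤ) :
    act γ (v - w) = act γ v - act γ w := Matrix.mulVec_sub _ _ _

theorem dvd_mulVec {ι κ : Type*} [Fintype κ] (A : Matrix ι κ ℤ) {v : κ → ℤ} (h : ∀ x, n ∣ v x)
    (x : ι) : n ∣ (A *ᵥ v) x :=
  Finset.dvd_sum fun y _ => Dvd.dvd.mul_left (h y) _

/-- The principal congruence subgroup of level `n`. -/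
def congruence (l : Type*) [DecidableEq l] [Fintype l] (n : ℤ) :
    Subgroup (symplecticGroup l ℤ) where
  carrier := {γ | ∀ v x, n ∣ act γ v x - v x}
  one_mem' v x := by simp [act_one]
  mul_mem' {γ δ} hγ hδ v x := by
    rw [act_mul]
    exact (dvd_add (hγ (act δ v) x) (hδ v x)).trans (dvd_of_eq (by ring))
  inv_mem' {γ} hγ v x := by
    have := hγ (act γ⁻¹ v) x
    rw [← act_mul, mul_inv_cancel, act_one] at this
    rwa [← dvd_neg, neg_sub]

theorem mem_congruence_iff_entries {γ : symplecticGroup l ℤ} :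
    γ ∈ congruence l n ↔ ∀ x y, n ∣ (γ.1 - 1) x y := by
  constructor
  · intro h x y
    have := h (Pi.single y 1) x
    rw [act, Matrix.mulVec_single_one] at this
    simpa [Matrix.one_apply, Pi.single_apply] using this
  · intro h v x
    have : act γ v x - v x = ((γ.1 - 1) *ᵥ v) x := by
      rw [Matrix.sub_mulVec, Matrix.one_mulVec]; rfl
    rw [this]
    exact Finset.dvd_sum fun y _ => Dvd.dvd.mul_right (h x y) _

instance : (congruence l n).Normal where
  conj_mem γ hγ δ v x := by
    rw [act_mul, act_mul]
    have h1 : act δ (act γ (act δ⁻¹ v)) x - v x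
        = act δ (act γ (act δ⁻¹ v) - act δ⁻¹ v) x := by
      rw [act_sub, ← act_mul δ δ⁻¹, mul_inv_cancel, act_one]
      rfl
    rw [h1]
    exact dvd_mulVec _ (hγ _) x

theorem emb_mem_congruence (φ : m ↪ l) {M : symplecticGroup m ℤ} (h : M ∈ congruence m n) :
    emb φ M ∈ congruence l n := by
  intro v x
  rw [act, emb_mulVec, Pi.add_apply, add_sub_cancel_left]
  exact dvd_mulVec _ (h _) x

theorem mem_congruence_of_vec {γ : symplecticGroup (Fin 2) ℤ}
    (h : ∀ a₁ a₂ b₁ b₂, ∃ c₁ c₂ d₁ d₂, act γ (vec a₁ a₂ b₁ b₂) = vec c₁ c₂ d₁ d₂ ∧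
      n ∣ c₁ - a₁ ∧ n ∣ c₂ - a₂ ∧ n ∣ d₁ - b₁ ∧ n ∣ d₂ - b₂) : γ ∈ congruence (Fin 2) n := by
  intro v x
  rw [eq_vec v]
  obtain ⟨c₁, c₂, d₁, d₂, h, h₁, h₂, h₃, h₄⟩ := h (v (.inl 0)) (v (.inl 1)) (v (.inr 0)) (v (.inr 1))
  rw [h]
  rcases x with x | x <;> fin_cases x <;> assumption

theorem levi_upper_mem_congruence {t : ℤ} (h : n ∣ t) : levi (upper t) ∈ congruence (Fin 2) n :=
  mem_congruence_of_vec fun a₁ a₂ b₁ b₂ => ⟨_, _, _, _, act_levi_upper t a₁ a₂ b₁ b₂, by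
    simp [h.mul_right]⟩

/-- The principal congruence subgroup of `SL₂`. -/
def SLcongruence (n : ℤ) : Subgroup SL(2, ℤ) where
  carrier := {M | n ∣ M 0 0 - 1 ∧ n ∣ M 0 1 ∧ n ∣ M 1 0 ∧ n ∣ M 1 1 - 1}
  one_mem' := by simp
  mul_mem' {A B} := by
    rintro ⟨h₁, h₂, h₃, h₄⟩ ⟨h₅, h₆, h₇, h₈⟩
    simp only [Set.mem_ofPred_eq, SL_mul]
    refine ⟨?_, ?_, ?_, ?_⟩
    · exact (dvd_add (dvd_add (h₁.mul_right (B 0 0)) h₅) (h₂.mul_right (B 1 0))).trans (dvd_of_eq (by ring))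
    · exact dvd_add (h₆.mul_left _) (h₂.mul_right _)
    · exact dvd_add (h₃.mul_right _) (h₇.mul_left _)
    · exact (dvd_add (dvd_add (h₄.mul_right (B 1 1)) h₈) (h₃.mul_right (B 0 1))).trans (dvd_of_eq (by ring))
  inv_mem' {A} := by
    rintro ⟨h₁, h₂, h₃, h₄⟩
    simp only [Set.mem_ofPred_eq, SL_inv, dvd_neg]
    exact ⟨h₄, h₂, h₃, h₁⟩

theorem mem_SLcongruence {M : SL(2, ℤ)} : M ∈ SLcongruence n ↔
    n ∣ M 0 0 - 1 ∧ n ∣ M 0 1 ∧ n ∣ M 1 0 ∧ n ∣ M 1 1 - 1 := Iff.rfl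

theorem long_mem_congruence (i : l) {M : SL(2, ℤ)} :
    long i M ∈ congruence l n ↔ M ∈ SLcongruence n := by
  rw [mem_SLcongruence]
  constructor
  · intro h
    have h1 := h (Pi.single (.inl i) 1)
    have h2 := h (Pi.single (.inr i) 1)
    have h3 := h1 (.inl i)
    have h4 := h2 (.inl i)
    have h5 := h1 (.inr i)
    have h6 := h2 (.inr i)
    rw [act_long_inl] at h3 h4
    rw [act_long_inr] at h5 h6
    simp at h3 h4 h5 h6
    exact ⟨h3, h4, h5, h6⟩
  · rintro ⟨h₁, h₂, h₃, h₄⟩ v x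
    rcases x with x | x
    · by_cases hx : x = i
      · subst hx
        rw [act_long_inl]
        exact (dvd_add (h₁.mul_right (v (.inl x))) (h₂.mul_right (v (.inr x)))).trans (dvd_of_eq (by ring))
      · rw [act_long_inl_of_ne hx]; simp
    · by_cases hx : x = i
      · subst hx
        rw [act_long_inr]
        exact (dvd_add (h₃.mul_right (v (.inl x))) (h₄.mul_right (v (.inr x)))).trans (dvd_of_eq (by ring))
      · rw [act_long_inr_of_ne hx]; simp

theorem levi_mem_congruence {M : SL(2, ℤ)} (h : M ∈ SLcongruence n) :
    levi M ∈ congruence (Fin 2) n := by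
  obtain ⟨h₁, h₂, h₃, h₄⟩ := h
  refine mem_congruence_of_vec fun a₁ a₂ b₁ b₂ => ⟨_, _, _, _, act_levi M a₁ a₂ b₁ b₂, ?_, ?_, ?_, ?_⟩
  · exact (dvd_add (h₁.mul_right a₁) (h₂.mul_right a₂)).trans (dvd_of_eq (by ring))
  · exact (dvd_add (h₃.mul_right a₁) (h₄.mul_right a₂)).trans (dvd_of_eq (by ring))
  · exact (dvd_sub (h₄.mul_right b₁) (h₃.mul_right b₂)).trans (dvd_of_eq (by ring))
  · exact (dvd_sub (h₁.mul_right b₂) (h₂.mul_right b₁)).trans (dvd_of_eq (by ring))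

theorem upper_mem_SLcongruence {t : ℤ} (h : n ∣ t) : upper t ∈ SLcongruence n := by
  simp [mem_SLcongruence, h]

theorem lower_mem_SLcongruence {t : ℤ} (h : n ∣ t) : lower t ∈ SLcongruence n := by
  simp [mem_SLcongruence, h]

end Congruence

section Elementary

variable {l m : Type*} [DecidableEq l] [Fintype l] [DecidableEq m] [Fintype m] {n : ℤ}

/-- A normal subgroup containing the elementary symplectic matrices of level `n`. -/
structure ContainsElementary (n : ℤ) (H : Subgroup (symplecticGroup l ℤ)) : Prop where
  normal : H.Normal
  levi_mem : ∀ φ : Fin 2 ↪ l, emb φ (levi (upper n)) ∈ H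
  long_mem : ∀ i, long i (upper n) ∈ H

theorem upper_mul (s k : ℤ) : upper (s * k) = upper s ^ k := by
  let f : Multiplicative ℤ →* SL(2, ℤ) :=
    { toFun := fun t => upper t.toAdd
      map_one' := by apply SL_ext <;> rfl
      map_mul' := fun s t => upper_add s.toAdd t.toAdd }
  have := map_zpow f (Multiplicative.ofAdd s) k
  rw [← ofAdd_zsmul, smul_eq_mul, mul_comm] at this
  exact this

namespace ContainsElementary

variable {H : Subgroup (symplecticGroup l ℤ)} (hH : ContainsElementary n H)
include hH

theorem comap (φ : m ↪ l) : ContainsElementary n (H.comap (emb φ)) where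
  normal := hH.normal.comap _
  levi_mem ψ := by
    rw [Subgroup.mem_comap, emb_emb]
    exact hH.levi_mem _
  long_mem i := by
    rw [Subgroup.mem_comap, emb_long]
    exact hH.long_mem _

theorem long_upper_mem (i : l) {t : ℤ} (ht : n ∣ t) : long i (upper t) ∈ H := by
  obtain ⟨k, rfl⟩ := ht
  rw [upper_mul, map_zpow]
  exact zpow_mem (hH.long_mem i) k

theorem long_lower_mem (i : l) {t : ℤ} (ht : n ∣ t) : long i (lower t) ∈ H := by
  rw [← neg_neg t, ← weyl_conj_upper, map_mul, map_mul, map_inv]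
  exact hH.normal.conj_mem _ (hH.long_upper_mem i ((dvd_neg).2 ht)) _

theorem emb_levi_upper_mem (φ : Fin 2 ↪ l) {t : ℤ} (ht : n ∣ t) :
    emb φ (levi (upper t)) ∈ H := by
  obtain ⟨k, rfl⟩ := ht
  rw [upper_mul, map_zpow, map_zpow]
  exact zpow_mem (hH.levi_mem φ) k

theorem emb_levi_lower_mem (φ : Fin 2 ↪ l) {t : ℤ} (ht : n ∣ t) :
    emb φ (levi (lower t)) ∈ H := by
  rw [← neg_neg t, ← weyl_conj_upper]
  simp only [map_mul, map_inv]
  exact hH.normal.conj_mem _ (hH.emb_levi_upper_mem φ ((dvd_neg).2 ht)) _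

end ContainsElementary

namespace ContainsElementary

variable {H : Subgroup (symplecticGroup (Fin 2) ℤ)} (hH : ContainsElementary n H)
include hH

theorem levi_upper_mem {t : ℤ} (ht : n ∣ t) : levi (upper t) ∈ H := by
  have := hH.emb_levi_upper_mem (Function.Embedding.refl _) ht
  convert this
  refine ext_act fun v => ?_
  exact (emb_mulVec_comp (Function.Embedding.refl _) _ v).symm.trans
    (by funext x; rcases x with x | x <;> rfl)

theorem levi_lower_mem {t : ℤ} (ht : n ∣ t) : levi (lower t) ∈ H := by
  rw [← neg_neg t, ← weyl_conj_upper]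
  simp only [map_mul, map_inv]
  exact hH.normal.conj_mem _ (hH.levi_upper_mem ((dvd_neg).2 ht)) _

theorem shortUpper_mem {t : ℤ} (ht : n ∣ t) : shortUpper t ∈ H :=
  hH.normal.conj_mem _ (hH.levi_upper_mem ((dvd_neg).2 ht)) _

theorem shortLower_mem {t : ℤ} (ht : n ∣ t) : shortLower t ∈ H :=
  hH.normal.conj_mem _ (hH.levi_lower_mem ((dvd_neg).2 ht)) _

end ContainsElementary

theorem act_emb_levi_upper (φ : Fin 2 ↪ l) (t : ℤ) (v : l ⊕ l → ℤ) :
    act (emb φ (levi (upper t))) v = v + (Pi.single (.inl (φ 0)) (t * v (.inl (φ 1))) +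
      Pi.single (.inr (φ 1)) (-(t * v (.inr (φ 0))))) := by
  rw [act, emb_mulVec]
  have h := act_levi_upper t (v (.inl (φ 0))) (v (.inl (φ 1))) (v (.inr (φ 0))) (v (.inr (φ 1)))
  have e : v ∘ Sum.map φ φ = vec (v (.inl (φ 0))) (v (.inl (φ 1))) (v (.inr (φ 0)))
    (v (.inr (φ 1))) := eq_vec _
  rw [e]
  rw [act] at h
  rw [h]
  have e' : ∀ a₁ a₂ b₁ b₂ c₁ c₂ d₁ d₂ : ℤ, vec a₁ a₂ b₁ b₂ - vec c₁ c₂ d₁ d₂ =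
      vec (a₁ - c₁) (a₂ - c₂) (b₁ - d₁) (b₂ - d₂) := fun _ _ _ _ _ _ _ _ => eq_vec _
  rw [e', transpose_restr_mulVec_vec]
  simp

end Elementary

section Commutator

variable {l : Type*} [DecidableEq l] [Fintype l] {N : ℤ}

theorem commutator_levi_upper {i j k : l} (hij : i ≠ j) (hik : i ≠ k) (hkj : k ≠ j) (s t : ℤ) :
    ⁅emb (pair i k hik) (levi (upper s)), emb (pair k j hkj) (levi (upper t))⁆ =
      emb (pair i j hij) (levi (upper (s * t))) := by
  rw [commutatorElement_def, mul_inv_eq_iff_eq_mul, mul_inv_eq_iff_eq_mul]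
  refine ext_act fun v => ?_
  simp only [act_mul, act_emb_levi_upper, pair_zero, pair_one]
  ext x
  rcases x with x | x
  · by_cases h1 : x = i <;> by_cases h2 : x = k <;> by_cases h3 : x = j <;>
      simp_all <;> grind
  · by_cases h1 : x = i <;> by_cases h2 : x = k <;> by_cases h3 : x = j <;>
      simp_all <;> grind

theorem commutator_levi_shortUpper (s t : ℤ) :
    ⁅levi (upper s), shortUpper t⁆ = long 0 (upper (2 * s * t)) := by
  rw [commutatorElement_def, mul_inv_eq_iff_eq_mul, mul_inv_eq_iff_eq_mul]
  refine ext_vec fun a₁ a₂ b₁ b₂ => ?_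
  simp only [act_mul, act_levi_upper, act_shortUpper, act_long_zero_upper]
  apply vec_congr <;> ring

theorem commutator_levi_long (s t : ℤ) :
    ⁅levi (upper s), long 1 (upper t)⁆ = shortUpper (s * t) * long 0 (upper (s ^ 2 * t)) := by
  rw [commutatorElement_def, mul_inv_eq_iff_eq_mul, mul_inv_eq_iff_eq_mul]
  refine ext_vec fun a₁ a₂ b₁ b₂ => ?_
  simp only [act_mul, act_levi_upper, act_shortUpper, act_long_zero_upper, act_long_one_upper]
  apply vec_congr <;> ring

theorem containsElementary_commutator (hl : 3 ≤ Fintype.card l) (hN : Odd N) :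
    ContainsElementary (N ^ 2) ⁅congruence l N, congruence l N⁆ := by
  have hlevi : ∀ φ : Fin 2 ↪ l, ∀ t, N ^ 2 ∣ t → emb φ (levi (upper t)) ∈
      ⁅congruence l N, congruence l N⁆ := by
    intro φ t ht
    obtain ⟨k, hk⟩ : ∃ k, k ∉ ({φ 0, φ 1} : Finset l) := by
      by_contra! h
      have := Finset.card_le_card (show Finset.univ ⊆ ({φ 0, φ 1} : Finset l) from fun x _ => h x)
      have := Finset.card_le_two (a := φ 0) (b := φ 1)
      have := Finset.card_univ (α := l)
      omega
    simp only [Finset.mem_insert, Finset.mem_singleton, not_or] at hk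
    obtain ⟨c, rfl⟩ := ht
    rw [eq_pair φ, pow_two, mul_assoc,
      ← commutator_levi_upper (φ.injective.ne (by decide)) (Ne.symm hk.1) hk.2]
    exact Subgroup.commutator_mem_commutator
      (emb_mem_congruence _ (levi_upper_mem_congruence dvd_rfl))
      (emb_mem_congruence _ (levi_upper_mem_congruence (dvd_mul_right _ _)))
  refine ⟨inferInstance, fun φ => hlevi φ _ dvd_rfl, fun i => ?_⟩
  obtain ⟨j, hj⟩ : ∃ j, j ≠ i := by
    have : Nontrivial l := Fintype.one_lt_card_iff_nontrivial.1 (show 1 < Fintype.card l by omega)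
    exact exists_ne i
  set φ := pair i j hj.symm
  set H := ⁅congruence l N, congruence l N⁆
  have hshort : emb φ (shortUpper (N * N)) ∈ H := by
    rw [shortUpper]
    simp only [map_mul, map_inv]
    exact (inferInstance : H.Normal).conj_mem _ (hlevi φ _ (by simp [pow_two])) _
  have h2 : long i (upper (2 * N * N)) ∈ H := by
    have : emb φ (long 0 (upper (2 * N * N))) = long i (upper (2 * N * N)) := emb_long _ _ _
    rw [← this, ← commutator_levi_shortUpper, map_commutatorElement]
    refine Subgroup.commutator_mem_commutator
      (emb_mem_congruence _ (levi_upper_mem_congruence dvd_rfl))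
      (emb_mem_congruence _ ?_)
    exact (inferInstance : (congruence (Fin 2) N).Normal).conj_mem _
      (levi_upper_mem_congruence (by simp)) _
  have h3 : long i (upper (N ^ 2 * N)) ∈ H := by
    have : emb φ (long 0 (upper (N ^ 2 * N))) = long i (upper (N ^ 2 * N)) := emb_long _ _ _
    rw [← this, ← Subgroup.mul_mem_cancel_left H hshort, ← map_mul, ← commutator_levi_long,
      map_commutatorElement]
    refine Subgroup.commutator_mem_commutator
      (emb_mem_congruence _ (levi_upper_mem_congruence dvd_rfl))
      (emb_mem_congruence _ ((long_mem_congruence _).2 (upper_mem_SLcongruence dvd_rfl)))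
  obtain ⟨m, hm⟩ := hN
  have : N ^ 2 = N ^ 2 * N + 2 * N * N * (-m) := by rw [hm]; ring
  rw [this, upper_add, upper_mul (2 * N * N), map_mul, map_zpow]
  exact mul_mem h3 (zpow_mem h2 _)

end Commutator

theorem exists_isCoprime_add_mul {a b d x y z : ℤ} (hb : b ≠ 0)
    (h : x * a + y * d + z * b = 1) : ∃ t, IsCoprime (a + t * d) b := by
  set P : Finset ℕ := b.natAbs.primeFactors.filter fun p : ℕ => ¬ (p : ℤ) ∣ a with hP
  refine ⟨∏ p ∈ P, (p : ℤ), ?_⟩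
  by_contra hc
  rw [Int.isCoprime_iff_gcd_eq_one] at hc
  obtain ⟨p, hp, hpd⟩ := Nat.exists_prime_and_dvd hc
  have h1 : (p : ℤ) ∣ a + (∏ p ∈ P, (p : ℤ)) * d :=
    (Int.natCast_dvd_natCast.2 hpd).trans (Int.gcd_dvd_left _ _)
  have h2 : (p : ℤ) ∣ b := (Int.natCast_dvd_natCast.2 hpd).trans (Int.gcd_dvd_right _ _)
  have hpp : Prime (p : ℤ) := Nat.prime_iff_prime_int.1 hp
  by_cases hpa : (p : ℤ) ∣ a
  · rcases hpp.dvd_or_dvd ((dvd_add_right hpa).1 h1) with h3 | h3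
    · obtain ⟨q, hq, hpq⟩ := (hpp.dvd_finsetProd_iff _).1 h3
      rw [hP, Finset.mem_filter] at hq
      have : p = q := (Nat.prime_dvd_prime_iff_eq hp (Nat.prime_of_mem_primeFactors hq.1)).1
        (Int.natCast_dvd_natCast.1 hpq)
      exact hq.2 (this ▸ hpa)
    · exact hpp.not_dvd_one (h ▸ dvd_add (dvd_add (hpa.mul_left x) (h3.mul_left y)) (h2.mul_left z))
  · have hmem : p ∈ P := by
      rw [hP, Finset.mem_filter, Nat.mem_primeFactors]
      exact ⟨⟨hp, Int.natCast_dvd.1 h2, by simpa using hb⟩, hpa⟩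
    have h3 : (p : ℤ) ∣ ∏ p ∈ P, (p : ℤ) := Finset.dvd_prod_of_mem (fun p : ℕ => (p : ℤ)) hmem
    exact hpa ((dvd_add_left (h3.mul_right d)).1 h1)

theorem exists_SL_mul_eq_zero (a b : ℤ) : ∃ M : SL(2, ℤ), M 1 0 * a + M 1 1 * b = 0 := by
  by_cases h : a = 0 ∧ b = 0
  · exact ⟨1, by simp [h.1, h.2]⟩
  · have hg : (Int.gcd a b : ℤ) ≠ 0 := by
      simpa [Int.gcd_eq_zero_iff] using h
    obtain ⟨a', ha⟩ := Int.gcd_dvd_left (a := a) (b := b)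
    obtain ⟨b', hb⟩ := Int.gcd_dvd_right (a := a) (b := b)
    have hbez := Int.gcd_eq_gcd_ab a b
    refine ⟨SLmk (Int.gcdA a b) (Int.gcdB a b) (-b') a' ?_, ?_⟩
    · apply mul_left_cancel₀ hg
      linear_combination (-Int.gcdA a b) * ha - Int.gcdB a b * hb - hbez
    · simp only [SLmk_apply]
      linear_combination (-b') * ha + a' * hb

section Orbit

variable {n : ℤ} {H : Subgroup (symplecticGroup (Fin 2) ℤ)}

/-- The vector `v` can be moved to the first basis vector by an element of `H`. -/
def Reaches (H : Subgroup (symplecticGroup (Fin 2) ℤ)) (v : Fin 2 ⊕ Fin 2 → ℤ) : Prop :=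
  ∃ h ∈ H, act h v = vec 1 0 0 0

theorem Reaches.of_act_mem {h : symplecticGroup (Fin 2) ℤ} (hh : h ∈ H) {v : Fin 2 ⊕ Fin 2 → ℤ}
    (hv : Reaches H (act h v)) : Reaches H v := by
  obtain ⟨h', hh', e⟩ := hv
  exact ⟨h' * h, mul_mem hh' hh, by rw [act_mul, e]⟩

theorem Reaches.of_act_fixing (hH : H.Normal) {u : symplecticGroup (Fin 2) ℤ}
    (hu : act u (vec 1 0 0 0) = vec 1 0 0 0) {v : Fin 2 ⊕ Fin 2 → ℤ}
    (hv : Reaches H (act u v)) : Reaches H v := by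
  obtain ⟨h, hh, e⟩ := hv
  refine ⟨u⁻¹ * h * u, ?_, ?_⟩
  · simpa using hH.conj_mem h hh u⁻¹
  · rw [act_mul, act_mul, e]
    conv_lhs => rw [← hu]
    rw [act_inv_act]

variable (hH : ContainsElementary n H) {a₁ a₂ b₁ b₂ : ℤ}
include hH

theorem reaches_of_fst_eq_one (h₂ : n ∣ a₂) (h₃ : n ∣ b₁) (h₄ : n ∣ b₂) :
    Reaches H (vec 1 a₂ b₁ b₂) := by
  refine .of_act_mem (hH.shortLower_mem (t := -b₂) ((dvd_neg).2 h₄)) ?_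
  refine .of_act_mem (hH.levi_lower_mem (t := -a₂) ((dvd_neg).2 h₂)) ?_
  refine .of_act_mem (hH.long_lower_mem 0 (t := -(b₁ - b₂ * a₂))
    ((dvd_neg).2 (dvd_sub h₃ (h₄.mul_right _)))) ?_
  refine ⟨1, one_mem _, ?_⟩
  rw [act_one, act_shortLower, act_levi_lower, act_long_zero_lower]
  apply vec_congr <;> ring

theorem reaches_of_isCoprime_of_eq_zero (h₁ : n ∣ a₁ - 1) (h₂ : n ∣ a₂) (h₃ : n ∣ b₁)
    (hc : IsCoprime a₁ b₁) : Reaches H (vec a₁ a₂ b₁ 0) := by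
  obtain ⟨q, hq⟩ : n ∣ 1 - a₁ - a₂ := dvd_sub ((dvd_sub_comm).1 h₁) h₂
  obtain ⟨x, y, hxy⟩ := hc
  refine .of_act_mem (hH.levi_lower_mem (t := n * (q * x)) (dvd_mul_right _ _)) ?_
  refine .of_act_mem (hH.shortUpper_mem (t := n * (q * y)) (dvd_mul_right _ _)) ?_
  refine .of_act_fixing hH.normal (u := levi (upper 1)) ?_ ?_
  · rw [act_levi_upper]
    apply vec_congr <;> ring
  · rw [act_levi_lower, act_shortUpper, act_levi_upper]
    have : vec (a₁ + n * (q * y) * 0 + 1 * (a₂ + n * (q * x) * a₁ + n * (q * y) * (b₁ -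
        n * (q * x) * 0))) (a₂ + n * (q * x) * a₁ + n * (q * y) * (b₁ - n * (q * x) * 0))
        (b₁ - n * (q * x) * 0) (0 - 1 * (b₁ - n * (q * x) * 0)) = vec 1 (1 - a₁) b₁ (-b₁) := by
      apply vec_congr
      · linear_combination n * q * hxy - hq
      · linear_combination n * q * hxy - hq
      · ring
      · ring
    rw [this]
    exact reaches_of_fst_eq_one hH ((dvd_sub_comm).1 h₁) h₃ ((dvd_neg).2 h₃)

theorem reaches_of_isCoprime (h₁ : n ∣ a₁ - 1) (h₂ : n ∣ a₂) (h₃ : n ∣ b₁) (h₄ : n ∣ b₂)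
    (hc : IsCoprime a₁ b₁) : Reaches H (vec a₁ a₂ b₁ b₂) := by
  obtain ⟨M, hM⟩ := exists_SL_mul_eq_zero a₂ b₂
  refine .of_act_fixing hH.normal (u := long 1 M) ?_ ?_
  · rw [act_long_one]
    apply vec_congr <;> ring
  · rw [act_long_one, hM]
    exact reaches_of_isCoprime_of_eq_zero hH h₁ (dvd_add (h₂.mul_left _) (h₄.mul_left _)) h₃ hc

theorem reaches_of_unimodular_of_eq_zero (h₁ : n ∣ a₁ - 1) (h₂ : n ∣ a₂) (h₃ : n ∣ b₁)
    (h₀ : b₁ ≠ 0) {x y z : ℤ} (hu : x * a₁ + y * a₂ + z * b₁ = 1) :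
    Reaches H (vec a₁ a₂ b₁ 0) := by
  obtain ⟨t, ht⟩ := exists_isCoprime_add_mul h₀ hu
  refine .of_act_fixing hH.normal (u := levi (upper t)) ?_ ?_
  · rw [act_levi_upper]
    apply vec_congr <;> ring
  · rw [act_levi_upper]
    refine reaches_of_isCoprime hH ?_ h₂ h₃ ?_ ht
    · exact (dvd_add h₁ (h₂.mul_left t)).trans (dvd_of_eq (by ring))
    · exact (h₃.mul_left (-t)).trans (dvd_of_eq (by ring))

theorem reaches_of_unimodular (hn : 1 < n) (h₁ : n ∣ a₁ - 1) (h₂ : n ∣ a₂) (h₃ : n ∣ b₁)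
    (h₄ : n ∣ b₂) {x y z w : ℤ} (hu : x * a₁ + y * a₂ + z * b₁ + w * b₂ = 1) :
    Reaches H (vec a₁ a₂ b₁ b₂) := by
  obtain ⟨M, hM⟩ := exists_SL_mul_eq_zero a₂ b₂
  refine .of_act_fixing hH.normal (u := long 1 M) ?_ ?_
  · rw [act_long_one]
    apply vec_congr <;> ring
  · rw [act_long_one, hM]
    have hdet := SL_det M
    set d := M 0 0 * a₂ + M 0 1 * b₂ with hd
    have hnd : n ∣ d := dvd_add (h₂.mul_left _) (h₄.mul_left _)
    have hu' : x * a₁ + (y * M 1 1 - w * M 1 0) * d + z * b₁ = 1 := by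
      linear_combination hu + (y * a₂ + w * b₂) * hdet + (y * M 1 1 - w * M 1 0) * hd +
        (y * M 0 1 - w * M 0 0) * hM
    by_cases h₀ : b₁ = 0
    · subst h₀
      refine .of_act_mem (hH.long_lower_mem 0 (t := n) dvd_rfl) ?_
      rw [act_long_zero_lower]
      have ha : a₁ ≠ 0 := by
        rintro rfl
        have := Int.le_of_dvd one_pos ((dvd_neg).1 (by simpa using h₁) : n ∣ 1)
        omega
      refine reaches_of_unimodular_of_eq_zero hH h₁ hnd ?_ ?_ (x := x)
        (y := y * M 1 1 - w * M 1 0) (z := 0) ?_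
      · rw [zero_add]; exact dvd_mul_right _ _
      · rw [zero_add]; exact mul_ne_zero (by omega) ha
      · linear_combination hu'
    · exact reaches_of_unimodular_of_eq_zero hH h₁ hnd h₃ h₀ hu'

theorem exists_mem_fixing (h₁ : n ∣ a₁) (h₂ : n ∣ a₂) (h₄ : n ∣ b₂) :
    ∃ h ∈ H, act h (vec 1 0 0 0) = vec 1 0 0 0 ∧ act h (vec a₁ a₂ 1 b₂) = vec 0 0 1 0 := by
  refine ⟨long 0 (upper (-(a₁ + b₂ * a₂))) * (shortUpper (-a₂) * levi (upper b₂)),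
    mul_mem (hH.long_upper_mem 0 ((dvd_neg).2 (dvd_add h₁ (h₄.mul_right _))))
      (mul_mem (hH.shortUpper_mem ((dvd_neg).2 h₂)) (hH.levi_upper_mem h₄)), ?_, ?_⟩ <;>
  · simp only [act_mul, act_levi_upper, act_shortUpper, act_long_zero_upper]
    apply vec_congr <;> ring

end Orbit

section Reduction

variable {l : Type*} [DecidableEq l] [Fintype l] {n : ℤ}

theorem exists_act_eq_vec (v : Fin 2 ⊕ Fin 2 → ℤ) : ∃ M d e, act M v = vec d 0 e 0 := by
  rw [eq_vec v]
  obtain ⟨M₀, h₀⟩ := exists_SL_mul_eq_zero (v (.inl 0)) (v (.inr 0))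
  obtain ⟨M₁, h₁⟩ := exists_SL_mul_eq_zero (v (.inl 1)) (v (.inr 1))
  obtain ⟨M, h⟩ := exists_SL_mul_eq_zero (M₀ 0 0 * v (.inl 0) + M₀ 0 1 * v (.inr 0))
    (M₁ 0 0 * v (.inl 1) + M₁ 0 1 * v (.inr 1))
  refine ⟨levi M * long 1 M₁ * long 0 M₀, M 0 0 * (M₀ 0 0 * v (.inl 0) + M₀ 0 1 * v (.inr 0)) +
    M 0 1 * (M₁ 0 0 * v (.inl 1) + M₁ 0 1 * v (.inr 1)), 0, ?_⟩
  rw [act_mul, act_mul, act_long_zero, act_long_one, act_levi, h, h₀, h₁]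
  apply vec_congr rfl rfl <;> ring

theorem act_emb_comp {m : Type*} [DecidableEq m] [Fintype m] (φ : m ↪ l)
    (M : symplecticGroup m ℤ) (v : l ⊕ l → ℤ) :
    act (emb φ M) v ∘ Sum.map φ φ = act M (v ∘ Sum.map φ φ) := emb_mulVec_comp φ M v

theorem exists_clear (v : l ⊕ l → ℤ) (j : l) (K : Finset l) (hj : j ∉ K) :
    ∃ u ∈ localSubgroup (insert j K : Set l),
      ∀ k ∈ K, act u v (.inl k) = 0 ∧ act u v (.inr k) = 0 := by
  induction K using Finset.induction_on with
  | empty => exact ⟨1, one_mem _, by simp⟩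
  | insert k K hk ih =>
    simp only [Finset.mem_insert, not_or] at hj
    obtain ⟨u, hu, huv⟩ := ih hj.2
    obtain ⟨M, d, e, hM⟩ := exists_act_eq_vec (act u v ∘ Sum.map (pair j k hj.1) (pair j k hj.1))
    have hloc : emb (pair j k hj.1) M ∈ localSubgroup ({j, k} : Set l) :=
      emb_mem_localSubgroup _ _ fun x => by fin_cases x <;> simp
    refine ⟨emb (pair j k hj.1) M * u, mul_mem (localSubgroup_mono ?_ hloc)
      (localSubgroup_mono ?_ hu), ?_⟩
    · intro x; simp; tauto
    · intro x; simp; tauto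
    · rw [← act_emb_comp] at hM
      intro x hx
      rw [act_mul]
      rcases Finset.mem_insert.1 hx with rfl | hx'
      · exact ⟨congrFun hM (.inl 1), congrFun hM (.inr 1)⟩
      · have hne : x ∉ ({j, k} : Set l) := by
          rintro (rfl | rfl)
          exacts [hj.2 hx', hk hx']
        have h1 := mulVec_inl_of_mem hloc (act u v) hne
        have h2 := mulVec_inr_of_mem hloc (act u v) hne
        exact ⟨h1.trans (huv x hx').1, h2.trans (huv x hx').2⟩

/-- If the restriction of `v` to two coordinates can be moved by `M`, the values elsewhere vanish,
then so can `v`. -/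
theorem act_emb_eq_single (i j : l) (hij : i ≠ j) {v : l ⊕ l → ℤ}
    (hv : ∀ k, k ≠ i → k ≠ j → v (.inl k) = 0 ∧ v (.inr k) = 0) (M : symplecticGroup (Fin 2) ℤ)
    {c d : ℤ} (hM : act M (v ∘ Sum.map (pair i j hij) (pair i j hij)) = vec c 0 d 0) :
    act (emb (pair i j hij) M) v = Pi.single (.inl i) c + Pi.single (.inr i) d := by
  have hloc : emb (pair i j hij) M ∈ localSubgroup ({i, j} : Set l) :=
    emb_mem_localSubgroup _ _ fun x => by fin_cases x <;> simp
  rw [← act_emb_comp] at hM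
  have e1 := congrFun hM (.inl 0)
  have e2 := congrFun hM (.inl 1)
  have e3 := congrFun hM (.inr 0)
  have e4 := congrFun hM (.inr 1)
  simp only [Function.comp_apply, Sum.map_inl, Sum.map_inr, pair_zero, pair_one, vec,
    Sum.elim_inl, Sum.elim_inr] at e1 e2 e3 e4
  ext x
  rcases x with x | x <;> by_cases h1 : x = i
  · subst h1; rw [e1]; simp
  · by_cases h2 : x = j
    · subst h2; rw [e2]; simp [h1]
    · have := mulVec_inl_of_mem hloc v (i := x) (by simp [h1, h2])
      refine this.trans ?_
      simp [(hv x h1 h2).1, h1]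
  · subst h1; rw [e3]; simp
  · by_cases h2 : x = j
    · subst h2; rw [e4]; simp [h1]
    · have := mulVec_inr_of_mem hloc v (i := x) (by simp [h1, h2])
      refine this.trans ?_
      simp [(hv x h1 h2).2, h1]

theorem act_smul (γ : symplecticGroup l ℤ) (c : ℤ) (v : l ⊕ l → ℤ) :
    act γ (c • v) = c • act γ v := Matrix.mulVec_smul _ _ _

theorem act_single_inl_of_mem {S : Set l} {γ : symplecticGroup l ℤ} (hγ : γ ∈ localSubgroup S)
    {i : l} (hi : i ∉ S) (c : ℤ) : act γ (Pi.single (.inl i) c) = Pi.single (.inl i) c :=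
  hγ _ fun j hj => by
    have : j ≠ i := fun h => hi (h ▸ hj)
    simp [this]

theorem act_single_inr_of_mem {S : Set l} {γ : symplecticGroup l ℤ} (hγ : γ ∈ localSubgroup S)
    {i : l} (hi : i ∉ S) (c : ℤ) : act γ (Pi.single (.inr i) c) = Pi.single (.inr i) c :=
  hγ _ fun j hj => by
    have : j ≠ i := fun h => hi (h ▸ hj)
    simp [this]

theorem mem_localSubgroup_erase {S : Finset l} {i : l} {γ : symplecticGroup l ℤ}
    (hγ : γ ∈ localSubgroup (S : Set l))
    (h₁ : act γ (Pi.single (.inl i) 1) = Pi.single (.inl i) 1)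
    (h₂ : act γ (Pi.single (.inr i) 1) = Pi.single (.inr i) 1) :
    γ ∈ localSubgroup (S.erase i : Set l) := by
  intro v hv
  have e : v = (v - v (.inl i) • Pi.single (.inl i) 1 - v (.inr i) • Pi.single (.inr i) 1) +
      v (.inl i) • Pi.single (.inl i) 1 + v (.inr i) • Pi.single (.inr i) 1 := by abel
  change act γ v = v
  rw [e, act_add, act_add, act_smul, act_smul, h₁, h₂]
  congr 2
  refine hγ _ fun k hk => ?_
  by_cases hki : k = i
  · subst hki; simp
  · have := hv k (by simp [hki]; exact hk)
    simp [hki, this.1, this.2]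

theorem dvd_act_sub {u : symplecticGroup l ℤ} {v w : l ⊕ l → ℤ} (h : ∀ x, n ∣ v x - w x)
    (x : l ⊕ l) : n ∣ act u v x - act u w x := by
  have := dvd_mulVec u.1 (v := v - w) h x
  rwa [← act, act_sub] at this

variable {S : Finset l} {i j : l}

theorem exists_local_clear (hij : i ≠ j) (hj : j ∈ S) {v : l ⊕ l → ℤ}
    (hv : ∀ k ∉ S, v (.inl k) = 0 ∧ v (.inr k) = 0) :
    ∃ u ∈ localSubgroup (S.erase i : Set l),
      ∀ k, k ≠ i → k ≠ j → act u v (.inl k) = 0 ∧ act u v (.inr k) = 0 := by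
  obtain ⟨u, hu, hk⟩ := exists_clear v j ((S.erase i).erase j) (by simp)
  have hsub : (insert j ((S.erase i).erase j : Finset l) : Set l) ⊆ (S.erase i : Set l) := by
    intro x; simp; rintro (rfl | h)
    · exact ⟨hj, hij.symm⟩
    · tauto
  have hu' := localSubgroup_mono hsub hu
  refine ⟨u, hu', fun k h1 h2 => ?_⟩
  by_cases hkS : k ∈ S
  · exact hk k (by simp [h1, h2, hkS])
  · have hne : k ∉ (S.erase i : Set l) := by simp [hkS]
    exact ⟨(mulVec_inl_of_mem hu' v hne).trans (hv k hkS).1,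
      (mulVec_inr_of_mem hu' v hne).trans (hv k hkS).2⟩

theorem dotProduct_J_mulVec_of_support (hij : i ≠ j) {v : l ⊕ l → ℤ}
    (hv : ∀ k, k ≠ i → k ≠ j → v (.inl k) = 0 ∧ v (.inr k) = 0) (w : l ⊕ l → ℤ) :
    w ⬝ᵥ (J l ℤ *ᵥ v) = w (.inr i) * v (.inl i) + w (.inr j) * v (.inl j) +
      -w (.inl i) * v (.inr i) + -w (.inl j) * v (.inr j) := by
  have hs : ∀ f : l → ℤ, (∀ k, k ≠ i → k ≠ j → f k = 0) → ∑ k, f k = f i + f j := by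
    intro f hf
    rw [← Finset.sum_pair hij]
    refine (Finset.sum_subset (Finset.subset_univ _) fun k _ hk => ?_).symm
    simp only [Finset.mem_insert, Finset.mem_singleton, not_or] at hk
    exact hf k hk.1 hk.2
  simp only [dotProduct, Fintype.sum_sum_type, J_mulVec_inl, J_mulVec_inr]
  rw [hs _ fun k h1 h2 => by simp [(hv k h1 h2).2], hs _ fun k h1 h2 => by simp [(hv k h1 h2).1]]
  ring

theorem emb_pair_mem_localSubgroup (hij : i ≠ j) (hi : i ∈ S) (hj : j ∈ S)
    (M : symplecticGroup (Fin 2) ℤ) : emb (pair i j hij) M ∈ localSubgroup (S : Set l) :=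
  emb_mem_localSubgroup _ _ fun x => by fin_cases x <;> simpa

variable {H : Subgroup (symplecticGroup l ℤ)} (hH : ContainsElementary n H)
include hH

theorem exists_act_eq_single_inl (hn : 1 < n) (hij : i ≠ j) (hi : i ∈ S) (hj : j ∈ S)
    {v w : l ⊕ l → ℤ} (hv : ∀ k ∉ S, v (.inl k) = 0 ∧ v (.inr k) = 0)
    (hvn : ∀ x, n ∣ v x - Pi.single (M := fun _ => ℤ) (.inl i) 1 x)
    (hw : w ⬝ᵥ (J l ℤ *ᵥ v) = 1) :
    ∃ h ∈ H, h ∈ localSubgroup (S : Set l) ∧ act h v = Pi.single (.inl i) 1 := by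
  obtain ⟨u, hu, huv⟩ := exists_local_clear hij hj hv
  have hui : act u (Pi.single (.inl i) 1) = Pi.single (.inl i) 1 :=
    act_single_inl_of_mem hu (by simp) 1
  have hn' := dvd_act_sub (u := u) hvn
  rw [hui] at hn'
  have hw' : act u w ⬝ᵥ (J l ℤ *ᵥ act u v) = 1 := (dotProduct_J_mulVec u w v).trans hw
  rw [dotProduct_J_mulVec_of_support hij huv] at hw'
  obtain ⟨h, hh, he⟩ := reaches_of_unimodular (hH.comap (pair i j hij)) hn
    (by simpa using hn' (.inl i)) (by simpa [hij.symm] using hn' (.inl j))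
    (by simpa using hn' (.inr i)) (by simpa using hn' (.inr j)) hw'
  have he' := act_emb_eq_single i j hij huv h (c := 1) (d := 0) (by
    rw [← he]; congr 1; exact eq_vec _)
  have huS : u ∈ localSubgroup (S : Set l) := localSubgroup_mono (by simp) hu
  refine ⟨u⁻¹ * emb (pair i j hij) h * u, ?_, ?_, ?_⟩
  · simpa using hH.normal.conj_mem _ hh u⁻¹
  · exact mul_mem (mul_mem (inv_mem huS) (emb_pair_mem_localSubgroup hij hi hj h)) huS
  · rw [act_mul, act_mul, he', Pi.single_zero, add_zero]
    conv_lhs => rw [← hui]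
    rw [act_inv_act]

theorem exists_act_eq_single_inr (hij : i ≠ j) (hi : i ∈ S) (hj : j ∈ S)
    {v : l ⊕ l → ℤ} (hv : ∀ k ∉ S, v (.inl k) = 0 ∧ v (.inr k) = 0)
    (hvn : ∀ x, n ∣ v x - Pi.single (M := fun _ => ℤ) (.inr i) 1 x) (hvi : v (.inr i) = 1) :
    ∃ h ∈ H, h ∈ localSubgroup (S : Set l) ∧
      act h (Pi.single (.inl i) 1) = Pi.single (.inl i) 1 ∧ act h v = Pi.single (.inr i) 1 := by
  obtain ⟨u, hu, huv⟩ := exists_local_clear hij hj hv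
  have hui : act u (Pi.single (.inl i) 1) = Pi.single (.inl i) 1 :=
    act_single_inl_of_mem hu (by simp) 1
  have hui' : act u (Pi.single (.inr i) 1) = Pi.single (.inr i) 1 :=
    act_single_inr_of_mem hu (by simp) 1
  have hn' := dvd_act_sub (u := u) hvn
  rw [hui'] at hn'
  have hvi' : act u v (.inr i) = 1 := (mulVec_inr_of_mem hu v (by simp)).trans hvi
  obtain ⟨h, hh, he, hf⟩ := exists_mem_fixing (hH.comap (pair i j hij))
    (by simpa using hn' (.inl i)) (by simpa using hn' (.inl j))
    (by simpa [hij.symm] using hn' (.inr j))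
  have he' := act_emb_eq_single i j hij (v := Pi.single (.inl i) 1) (by simp +contextual) h
    (c := 1) (d := 0) (by
      rw [← he]; congr 1; rw [eq_vec (_ ∘ _)]; apply vec_congr <;> simp [hij.symm])
  have hf' := act_emb_eq_single i j hij huv h (c := 0) (d := 1) (by
    rw [← hf, ← hvi']; congr 1; exact eq_vec _)
  have huS : u ∈ localSubgroup (S : Set l) := localSubgroup_mono (by simp) hu
  refine ⟨u⁻¹ * emb (pair i j hij) h * u, ?_, ?_, ?_, ?_⟩
  · simpa using hH.normal.conj_mem _ hh u⁻¹
  · exact mul_mem (mul_mem (inv_mem huS) (emb_pair_mem_localSubgroup hij hi hj h)) huS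
  · rw [act_mul, act_mul, hui, he', Pi.single_zero, add_zero]
    conv_lhs => rw [← hui]
    rw [act_inv_act]
  · rw [act_mul, act_mul, hf', Pi.single_zero, zero_add]
    conv_lhs => rw [← hui']
    rw [act_inv_act]

variable (hHn : H ≤ congruence l n)
include hHn

theorem exists_mul_mem_localSubgroup_erase (hn : 1 < n) (hij : i ≠ j) (hi : i ∈ S) (hj : j ∈ S)
    {γ : symplecticGroup l ℤ} (hγ : γ ∈ congruence l n) (hγS : γ ∈ localSubgroup (S : Set l)) :
    ∃ h ∈ H, h * γ ∈ localSubgroup (S.erase i : Set l) := by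
  have hsupp : ∀ δ ∈ localSubgroup (S : Set l), ∀ v : l ⊕ l → ℤ,
      (∀ k ∉ S, v (.inl k) = 0 ∧ v (.inr k) = 0) →
        ∀ k ∉ S, act δ v (.inl k) = 0 ∧ act δ v (.inr k) = 0 := fun δ hδ v hv k hk =>
    ⟨(mulVec_inl_of_mem hδ v hk).trans (hv k hk).1, (mulVec_inr_of_mem hδ v hk).trans (hv k hk).2⟩
  have hki : ∀ k ∉ S, k ≠ i := fun k hk h => hk (h ▸ hi)
  obtain ⟨h, hh, hhS, he⟩ := exists_act_eq_single_inl hH hn hij hi hj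
    (v := act γ (Pi.single (.inl i) 1)) (w := act γ (Pi.single (.inr i) 1))
    (hsupp γ hγS _ fun k hk => by simp [hki k hk]) (hγ _)
    ((dotProduct_J_mulVec γ _ _).trans (by rw [single_dotProduct, J_mulVec_inr]; simp))
  rw [← act_mul] at he
  have hdot := dotProduct_J_mulVec (h * γ) (Pi.single (.inr i) 1) (Pi.single (.inl i) 1)
  change act _ _ ⬝ᵥ (J l ℤ *ᵥ act _ _) = _ at hdot
  rw [he, dotProduct_J_mulVec_of_support hij (by simp +contextual), single_dotProduct,
    J_mulVec_inr] at hdot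
  obtain ⟨h', hh', hhS', he', hf'⟩ := exists_act_eq_single_inr hH hij hi hj
    (v := act (h * γ) (Pi.single (.inr i) 1))
    (hsupp _ (mul_mem hhS hγS) _ fun k hk => by simp [hki k hk])
    ((mul_mem (hHn hh) hγ : h * γ ∈ congruence l n) _) (by simpa [hij.symm] using hdot)
  refine ⟨h' * h, mul_mem hh' hh, ?_⟩
  rw [mul_assoc]
  refine mem_localSubgroup_erase (mul_mem hhS' (mul_mem hhS hγS)) ?_ ?_
  · rw [act_mul, he, he']
  · rw [act_mul, hf']

theorem exists_mul_mem_localSubgroup_insert (hn : 1 < n) {k : l} (K : Finset l) (hk : k ∉ K)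
    {γ : symplecticGroup l ℤ} (hγ : γ ∈ congruence l n)
    (hγK : γ ∈ localSubgroup (insert k K : Set l)) :
    ∃ h ∈ H, h * γ ∈ localSubgroup ({k} : Set l) := by
  induction K using Finset.induction_on generalizing γ with
  | empty => exact ⟨1, one_mem _, by simpa using hγK⟩
  | insert i K hi ih =>
    simp only [Finset.mem_insert, not_or] at hk
    obtain ⟨h, hh, hloc⟩ := exists_mul_mem_localSubgroup_erase hH hHn hn (i := i) (j := k)
      (S := insert k (insert i K)) (Ne.symm hk.1) (by simp) (by simp) hγ (by simpa using hγK)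
    obtain ⟨h', hh', hloc'⟩ := ih hk.2 (mul_mem (hHn hh) hγ)
      (localSubgroup_mono (by intro x; simp; tauto) hloc)
    exact ⟨h' * h, mul_mem hh' hh, by rwa [mul_assoc]⟩

theorem exists_mul_eq_long (hn : 1 < n) (k : l) {γ : symplecticGroup l ℤ}
    (hγ : γ ∈ congruence l n) :
    ∃ h ∈ H, ∃ M ∈ SLcongruence n, h * γ = long k M := by
  obtain ⟨h, hh, hloc⟩ := exists_mul_mem_localSubgroup_insert hH hHn hn (k := k)
    (Finset.univ.erase k) (by simp) hγ (fun v hv => by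
      have : v = 0 := by
        ext x
        rcases x with x | x
        exacts [(hv x (by simp)).1, (hv x (by simp)).2]
      rw [this, Matrix.mulVec_zero])
  obtain ⟨M, hM⟩ := exists_emb_eq ⟨fun _ : Unit => k, fun _ _ _ => rfl⟩ (γ := h * γ) (by
    convert hloc; exact Set.range_const)
  obtain ⟨M', rfl⟩ := exists_ofSL_eq M
  have hM' : long k M' = h * γ := hM
  exact ⟨h, hh, M', (long_mem_congruence k).1 (hM' ▸ mul_mem (hHn hh) hγ), hM'.symm⟩

omit hH hHn

theorem commutator_le_congruence (N : ℤ) :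
    ⁅congruence l N, congruence l N⁆ ≤ congruence l (N ^ 2) := by
  rw [Subgroup.commutator_le]
  intro γ hγ δ hδ v x
  obtain ⟨w, rfl⟩ : ∃ w, v = act (δ * γ) w := ⟨act (δ * γ)⁻¹ v, by
    rw [← act_mul, mul_inv_cancel, act_one]⟩
  have key : ∀ γ ∈ congruence l N, ∀ δ ∈ congruence l N, ∀ w x,
      N ^ 2 ∣ (act γ (act δ w - w) - (act δ w - w)) x := by
    intro γ hγ δ hδ w x
    choose q hq using hδ w
    have : act δ w - w = N • q := by ext y; simpa using hq y
    rw [this, act_smul, ← smul_sub, sq]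
    exact mul_dvd_mul_left _ (hγ q x)
  have e : act ⁅γ, δ⁆ (act (δ * γ) w) = act (γ * δ) w := by
    rw [← act_mul, commutatorElement_def]; congr 1; group
  have h := dvd_sub (key γ hγ δ hδ w x) (key δ hδ γ hγ w x)
  rw [e]
  refine h.trans (dvd_of_eq ?_)
  simp only [act_sub, act_mul, Pi.sub_apply]
  ring

end Reduction

section RowSymbol

variable {n : ℤ} {C : Type*} [CommGroup C]

/-- A map on `SL(2, ℤ)` which is multiplicative on the principal congruence subgroup of level `n`,
trivial on its elementary generators and invariant under conjugation by lower unipotents. -/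
structure IsElementaryInvariant (n : ℤ) (χ : SL(2, ℤ) → C) : Prop where
  mul : ∀ M ∈ SLcongruence n, ∀ M' ∈ SLcongruence n, χ (M * M') = χ M * χ M'
  upper : ∀ t, n ∣ t → χ (upper t) = 1
  lower : ∀ t, n ∣ t → χ (lower t) = 1
  conj : ∀ t, ∀ M ∈ SLcongruence n, χ (SymplecticGroup.lower t * M * (SymplecticGroup.lower t)⁻¹) = χ M

open Classical in
/-- The value of `χ` at an element of the congruence subgroup with first row `(a, b)`. -/
noncomputable def rowSymbol (n : ℤ) (χ : SL(2, ℤ) → C) (a b : ℤ) : C :=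
  if h : ∃ M ∈ SLcongruence n, M 0 0 = a ∧ M 0 1 = b then χ h.choose else 1

theorem exists_mem_SLcongruence {a b : ℤ} (h : IsLevelRow n a b) :
    ∃ M ∈ SLcongruence n, M 0 0 = a ∧ M 0 1 = b := by
  obtain ⟨c, d, hdet, hc, hd⟩ := h.exists_matrix
  exact ⟨SLmk a b c d hdet, by simp [mem_SLcongruence, h.dvd_sub_one, h.dvd_right, hc, hd],
    by simp, by simp⟩

theorem isLevelRow_of_mem {M : SL(2, ℤ)} (hM : M ∈ SLcongruence n) :
    IsLevelRow n (M 0 0) (M 0 1) where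
  dvd_sub_one := hM.1
  dvd_right := hM.2.1
  isCoprime := ⟨M 1 1, -M 1 0, by linear_combination SL_det M⟩

namespace IsElementaryInvariant

variable {χ : SL(2, ℤ) → C} (hχ : IsElementaryInvariant n χ)
include hχ

theorem eq_of_row_eq {M M' : SL(2, ℤ)} (hM : M ∈ SLcongruence n) (hM' : M' ∈ SLcongruence n)
    (h₀ : M 0 0 = M' 0 0) (h₁ : M 0 1 = M' 0 1) : χ M = χ M' := by
  have hdet := SL_det M
  have hdet' := SL_det M'
  have e : M = SymplecticGroup.lower (M 1 0 * M' 1 1 - M 1 1 * M' 1 0) * M' := by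
    apply SL_ext <;> simp only [SL_mul, lower_apply]
    · linear_combination h₀
    · linear_combination h₁
    · rw [h₀, h₁] at hdet
      linear_combination M' 1 0 * hdet - M 1 0 * hdet'
    · rw [h₀, h₁] at hdet
      linear_combination M' 1 1 * hdet - M 1 1 * hdet'
  have hn : n ∣ M 1 0 * M' 1 1 - M 1 1 * M' 1 0 :=
    dvd_sub (hM.2.2.1.mul_right _) (hM'.2.2.1.mul_left _)
  rw [e, hχ.mul _ (lower_mem_SLcongruence hn) _ hM', hχ.lower _ hn, one_mul]

theorem rowSymbol_eq {M : SL(2, ℤ)} (hM : M ∈ SLcongruence n) {a b : ℤ} (ha : M 0 0 = a)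
    (hb : M 0 1 = b) : rowSymbol n χ a b = χ M := by
  have h : ∃ M ∈ SLcongruence n, M 0 0 = a ∧ M 0 1 = b := ⟨M, hM, ha, hb⟩
  rw [rowSymbol, dif_pos h]
  exact hχ.eq_of_row_eq h.choose_spec.1 hM (h.choose_spec.2.1.trans ha.symm)
    (h.choose_spec.2.2.trans hb.symm)

theorem isRowSymbol : IsRowSymbol n (rowSymbol n χ) where
  add_right a b t h := by
    obtain ⟨M, hM, ha, hb⟩ := exists_mem_SLcongruence h
    have hu := dvd_mul_right n t
    rw [hχ.rowSymbol_eq hM ha hb, hχ.rowSymbol_eq (mul_mem hM (upper_mem_SLcongruence hu))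
      (by simp [SL_mul, ha]) (by simp [SL_mul, ha, hb]; ring),
      hχ.mul _ hM _ (upper_mem_SLcongruence hu), hχ.upper _ hu, mul_one]
  add_left a b t h := by
    obtain ⟨M, hM, ha, hb⟩ := exists_mem_SLcongruence h
    have ⟨h₁, h₂, h₃, h₄⟩ := hM
    rw [hχ.rowSymbol_eq hM ha hb, ← hχ.conj (-t) M hM]
    refine hχ.rowSymbol_eq ?_ ?_ ?_
    · simp only [mem_SLcongruence, SL_mul, SL_inv, lower_apply]
      refine ⟨(dvd_add h₁ (h₂.mul_left t)).trans (dvd_of_eq (by ring)),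
        h₂.trans (dvd_of_eq (by ring)), ?_,
        (dvd_sub h₄ (h₂.mul_left t)).trans (dvd_of_eq (by ring))⟩
      exact (dvd_add (dvd_sub h₃ (h₂.mul_left (t * t))) ((dvd_sub h₄ h₁).mul_left t)).trans
        (dvd_of_eq (by ring))
    · simp [SL_mul, SL_inv, ha, hb]; ring
    · simp [SL_mul, SL_inv, ha, hb]
  one_zero := by
    rw [hχ.rowSymbol_eq (one_mem _) (by simp) (by simp)]
    simpa using hχ.mul 1 (one_mem _) 1 (one_mem _)

theorem rowSymbol_mul {a b c d a' b' c' d' : ℤ} (h : a * d - b * c = 1)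
    (h' : a' * d' - b' * c' = 1) (hab : IsLevelRow n a b) (hc : n ∣ c) (hd : n ∣ d - 1)
    (hab' : IsLevelRow n a' b') (hc' : n ∣ c') (hd' : n ∣ d' - 1) :
    rowSymbol n χ (a * a' + b * c') (a * b' + b * d') =
      rowSymbol n χ a b * rowSymbol n χ a' b' := by
  have hM : SLmk a b c d h ∈ SLcongruence n := by
    simp [mem_SLcongruence, hab.dvd_sub_one, hab.dvd_right, hc, hd]
  have hM' : SLmk a' b' c' d' h' ∈ SLcongruence n := by
    simp [mem_SLcongruence, hab'.dvd_sub_one, hab'.dvd_right, hc', hd']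
  rw [hχ.rowSymbol_eq hM (a := a) (b := b) (by simp) (by simp),
    hχ.rowSymbol_eq hM' (a := a') (b := b') (by simp) (by simp), ← hχ.mul _ hM _ hM']
  exact hχ.rowSymbol_eq (mul_mem hM hM') (by simp [SL_mul]) (by simp [SL_mul])

end IsElementaryInvariant

end RowSymbol

theorem levi_mul_long_eq {a b₁ c₁ d₁ b₂ c₂ d₂ : ℤ} (hA : a * d₂ - b₂ * c₂ = 1)
    (hB : a * d₁ - b₁ * c₁ = 1) (hD : a * (d₂ - b₂ * c₂ * d₁ + b₁ * b₂ * c₁ * c₂ * d₂) -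
      b₁ * b₂ ^ 2 * (c₁ * c₂ ^ 2) = 1) :
    long 1 (lower (-(a * c₁))) * (shortLower (c₁ * c₂) *
      (levi (SLmk a b₂ c₂ d₂ hA) * (long 1 (SLmk a b₁ c₁ d₁ hB) * (levi (upper (-b₂)) *
        (levi (lower (-c₂)) * (shortUpper (-(d₂ * b₁ * b₂)) *
          long 1 (upper (-(d₂ * b₁ * (1 + c₂ * b₂)))))))))) =
    long 0 (SLmk a (b₁ * b₂ ^ 2) (c₁ * c₂ ^ 2)
      (d₂ - b₂ * c₂ * d₁ + b₁ * b₂ * c₁ * c₂ * d₂) hD) := by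
  refine ext_vec fun x₁ x₂ y₁ y₂ => ?_
  simp only [act_mul, act_shortLower, act_shortUpper, act_levi, act_long_one, act_long_zero,
    SLmk_apply, upper_apply, lower_apply]
  apply vec_congr
  · grind
  · grind
  · grind
  · grind

theorem levi_weyl_mul_long (M : SL(2, ℤ)) : levi weyl * long 1 M * (levi weyl)⁻¹ = long 0 M := by
  rw [mul_inv_eq_iff_eq_mul]
  refine ext_vec fun x₁ x₂ y₁ y₂ => ?_
  simp only [act_mul, act_levi, act_long_one, act_long_zero, weyl_apply]
  apply vec_congr <;> ring

section Symbol

variable {l : Type*} [DecidableEq l] [Fintype l] {n : ℤ} {C : Type*} [CommGroup C]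

/-- A map which is multiplicative on the principal congruence subgroup of level `n` and trivial on
`H`. -/
structure IsMulModulo (n : ℤ) (H : Subgroup (symplecticGroup l ℤ))
    (R : symplecticGroup l ℤ → C) : Prop where
  mul : ∀ γ ∈ congruence l n, ∀ δ ∈ congruence l n, R (γ * δ) = R γ * R δ
  eq_one : ∀ γ ∈ H, R γ = 1

variable {H : Subgroup (symplecticGroup l ℤ)} {R : symplecticGroup l ℤ → C}
  (hR : IsMulModulo n H R) (hH : ContainsElementary n H) (hHn : H ≤ congruence l n)

namespace IsMulModulo

include hR hHn

theorem apply_mem_mul {γ h : symplecticGroup l ℤ} (hh : h ∈ H) (hγ : γ ∈ congruence l n) :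
    R (h * γ) = R γ := by
  rw [hR.mul _ (hHn hh) _ hγ, hR.eq_one _ hh, one_mul]

theorem apply_mul_mem {γ h : symplecticGroup l ℤ} (hh : h ∈ H) (hγ : γ ∈ congruence l n) :
    R (γ * h) = R γ := by
  rw [hR.mul _ hγ _ (hHn hh), hR.eq_one _ hh, mul_one]

include hH

theorem conj_emb (hl : 3 ≤ Fintype.card l) (hn : 1 < n) (φ : Fin 2 ↪ l)
    (u : symplecticGroup (Fin 2) ℤ) {γ : symplecticGroup l ℤ} (hγ : γ ∈ congruence l n) :
    R (emb φ u * γ * (emb φ u)⁻¹) = R γ := by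
  obtain ⟨k, hk⟩ : ∃ k, k ∉ Finset.univ.map φ := by
    by_contra! hc
    have := Finset.card_le_card (fun k _ => hc k : (Finset.univ : Finset l) ⊆ _)
    rw [Finset.card_map, Finset.card_univ, Finset.card_univ, Fintype.card_fin] at this
    omega
  obtain ⟨h, hh, M, hM, e⟩ := exists_mul_eq_long hH hHn hn k hγ
  have hcomm : Commute (emb φ u) (long k M) := emb_commute _ _ (fun x _ hx => hk (by
    rw [Finset.mem_map]; exact ⟨x, Finset.mem_univ _, hx⟩)) _ _
  have e' : emb φ u * γ * (emb φ u)⁻¹ = (emb φ u * h⁻¹ * (emb φ u)⁻¹) * long k M := by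
    have : γ = h⁻¹ * long k M := by rw [← e, inv_mul_cancel_left]
    rw [this, mul_assoc _ _ (long k M), hcomm.inv_left.eq]
    simp only [mul_assoc]
  rw [e', hR.apply_mem_mul hHn (hH.normal.conj_mem _ (inv_mem hh) _) ((long_mem_congruence k).2 hM), ← e,
    hR.apply_mem_mul hHn hh hγ]

theorem isElementaryInvariant_long (hl : 3 ≤ Fintype.card l) (hn : 1 < n) (φ : Fin 2 ↪ l) :
    IsElementaryInvariant n fun M => R (long (φ 0) M) where
  mul M hM M' hM' := by
    rw [map_mul, hR.mul _ ((long_mem_congruence _).2 hM) _ ((long_mem_congruence _).2 hM')]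
  upper t ht := hR.eq_one _ (hH.long_upper_mem _ ht)
  lower t ht := hR.eq_one _ (hH.long_lower_mem _ ht)
  conj t M hM := by
    rw [map_mul, map_mul, map_inv, ← emb_long φ 0 (SymplecticGroup.lower t)]
    exact hR.conj_emb hH hHn hl hn φ _ ((long_mem_congruence _).2 hM)

theorem isElementaryInvariant_levi (hl : 3 ≤ Fintype.card l) (hn : 1 < n) (φ : Fin 2 ↪ l) :
    IsElementaryInvariant n fun M => R (emb φ (levi M)) where
  mul M hM M' hM' := by
    rw [map_mul, map_mul, hR.mul _ (emb_mem_congruence φ (levi_mem_congruence hM)) _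
      (emb_mem_congruence φ (levi_mem_congruence hM'))]
  upper t ht := hR.eq_one _ (hH.emb_levi_upper_mem φ ht)
  lower t ht := hR.eq_one _ (hH.emb_levi_lower_mem φ ht)
  conj t M hM := by
    simp only [map_mul, map_inv]
    exact hR.conj_emb hH hHn hl hn φ _ (emb_mem_congruence φ (levi_mem_congruence hM))

theorem rowSymbol_link (hl : 3 ≤ Fintype.card l) (hn : 1 < n) (φ : Fin 2 ↪ l) {a b c : ℤ}
    (hb : IsLevelRow n a b) (hc : IsLevelRow n a c) :
    rowSymbol n (fun M => R (long (φ 0) M)) a (b * c ^ 2) =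
      rowSymbol n (fun M => R (long (φ 0) M)) a b *
        rowSymbol n (fun M => R (emb φ (levi M))) a c := by
  obtain ⟨c₁, d₁, hB, hc₁, hd₁⟩ := hb.exists_matrix
  obtain ⟨c₂, d₂, hA, hc₂, hd₂⟩ := hc.exists_matrix
  have hD : a * (d₂ - c * c₂ * d₁ + b * c * c₁ * c₂ * d₂) - b * c ^ 2 * (c₁ * c₂ ^ 2) = 1 := by
    linear_combination (1 + b * c * c₁ * c₂) * hA - c * c₂ * hB
  have hBm : SLmk a b c₁ d₁ hB ∈ SLcongruence n := by
    simp [mem_SLcongruence, hb.dvd_sub_one, hb.dvd_right, hc₁, hd₁]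
  have hAm : SLmk a c c₂ d₂ hA ∈ SLcongruence n := by
    simp [mem_SLcongruence, hc.dvd_sub_one, hc.dvd_right, hc₂, hd₂]
  have hDm : SLmk a (b * c ^ 2) (c₁ * c₂ ^ 2) (d₂ - c * c₂ * d₁ + b * c * c₁ * c₂ * d₂) hD ∈
      SLcongruence n := by
    simp only [mem_SLcongruence, SLmk_apply]
    refine ⟨hc.dvd_sub_one, hb.dvd_right.mul_right _, hc₁.mul_right _, ?_⟩
    exact (dvd_add (dvd_sub hd₂ (hc₂.mul_left (c * d₁))) (hc₁.mul_left (b * c * c₂ * d₂))).trans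
      (dvd_of_eq (by ring))
  rw [(hR.isElementaryInvariant_long hH hHn hl hn φ).rowSymbol_eq hDm (by simp) (by simp),
    (hR.isElementaryInvariant_long hH hHn hl hn φ).rowSymbol_eq hBm (by simp) (by simp),
    (hR.isElementaryInvariant_levi hH hHn hl hn φ).rowSymbol_eq hAm (by simp) (by simp)]
  have e := congrArg (emb φ) (levi_mul_long_eq hA hB hD)
  simp only [map_mul, emb_long] at e
  have hφ := hH.comap φ
  have h1 := hH.long_lower_mem (φ 1) ((dvd_neg).2 (hc₁.mul_left a))
  have h2 : emb φ (shortLower (c₁ * c₂)) ∈ H := hφ.shortLower_mem (hc₁.mul_right _)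
  have h3 := hH.emb_levi_upper_mem φ ((dvd_neg).2 hc.dvd_right)
  have h4 := hH.emb_levi_lower_mem φ ((dvd_neg).2 hc₂)
  have h5 : emb φ (shortUpper (-(d₂ * b * c))) ∈ H :=
    hφ.shortUpper_mem ((dvd_neg).2 (hc.dvd_right.mul_left _))
  have h6 := hH.long_upper_mem (φ 1)
    ((dvd_neg).2 ((hb.dvd_right.mul_left d₂).mul_right (1 + c₂ * c)))
  have hE := mul_mem h3 (mul_mem h4 (mul_mem h5 h6))
  have hAΓ : emb φ (levi (SLmk a c c₂ d₂ hA)) ∈ congruence l n :=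
    emb_mem_congruence φ (levi_mem_congruence hAm)
  have hBΓ : long (φ 1) (SLmk a b c₁ d₁ hB) ∈ congruence l n := (long_mem_congruence _).2 hBm
  have hBE := mul_mem hBΓ (hHn hE)
  rw [← e, hR.apply_mem_mul hHn h1 (mul_mem (hHn h2) (mul_mem hAΓ hBE)),
    hR.apply_mem_mul hHn h2 (mul_mem hAΓ hBE), hR.mul _ hAΓ _ hBE, hR.apply_mul_mem hHn hE hBΓ, mul_comm]
  congr 1
  rw [← hR.conj_emb hH hHn hl hn φ (levi weyl) hBΓ, ← emb_long φ 1, ← map_inv, ← map_mul, ← map_mul,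
    levi_weyl_mul_long, emb_long]

theorem eq_one_of_mem_congruence (hl : 3 ≤ Fintype.card l) (hn : 1 < n) (hno : Odd n)
    {γ : symplecticGroup l ℤ} (hγ : γ ∈ congruence l n) : R γ = 1 := by
  obtain ⟨φ⟩ : Nonempty (Fin 2 ↪ l) := Function.Embedding.nonempty_of_card_le (by
    rw [Fintype.card_fin]; omega)
  obtain ⟨h, hh, M, hM, e⟩ := exists_mul_eq_long hH hHn hn (φ 0) hγ
  have hf := hR.isElementaryInvariant_long hH hHn hl hn φ
  have hs := hR.isElementaryInvariant_levi hH hHn hl hn φ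
  rw [← hR.apply_mem_mul hHn hh hγ, e]
  have := hf.rowSymbol_eq hM rfl rfl
  refine this.symm.trans ?_
  exact hf.isRowSymbol.eq_one_of_link hs.isRowSymbol hno hn
    (fun a b c hb hc => hR.rowSymbol_link hH hHn hl hn φ hb hc)
    (fun _ _ _ _ _ _ _ _ h h' hab hc hd hab' hc' hd' =>
      hs.rowSymbol_mul h h' hab hc hd hab' hc' hd')
    (isLevelRow_of_mem hM)

end IsMulModulo

end Symbol

section Commutator

variable {l : Type*} [DecidableEq l] [Fintype l]

open Classical in
theorem congruence_sq_le_commutator {N : ℤ} (hl : 3 ≤ Fintype.card l) (hN : Odd N) (hN1 : 1 < N) :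
    congruence l (N ^ 2) ≤ ⁅congruence l N, congruence l N⁆ := by
  have hle : congruence l (N ^ 2) ≤ congruence l N := fun γ hγ v x =>
    (dvd_pow_self N two_ne_zero).trans (hγ v x)
  have hsub : ∀ γ : congruence l N, Abelianization.of γ = 1 →
      (γ : symplecticGroup l ℤ) ∈ ⁅congruence l N, congruence l N⁆ := by
    intro γ hγ
    rw [← MonoidHom.mem_ker, Abelianization.ker_of] at hγ
    rw [← Subgroup.map_subtype_commutator]
    exact Subgroup.mem_map_of_mem _ hγ
  have hone : ∀ γ : congruence l N, (γ : symplecticGroup l ℤ) ∈ ⁅congruence l N, congruence l N⁆ →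
      Abelianization.of γ = 1 := by
    intro γ hγ
    rw [← Subgroup.map_subtype_commutator] at hγ
    obtain ⟨δ, hδ, e⟩ := hγ
    rw [← MonoidHom.mem_ker, Abelianization.ker_of]
    rwa [← Subtype.ext e]
  let R : symplecticGroup l ℤ → Abelianization (congruence l N) := fun γ =>
    if h : γ ∈ congruence l N then Abelianization.of ⟨γ, h⟩ else 1
  have hRe : ∀ {γ} (h : γ ∈ congruence l N), R γ = Abelianization.of ⟨γ, h⟩ := fun h => dif_pos h
  have hcom : ⁅congruence l N, congruence l N⁆ ≤ congruence l N := Subgroup.commutator_le_left _ _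
  have hR : IsMulModulo (N ^ 2) ⁅congruence l N, congruence l N⁆ R :=
    { mul := fun γ hγ δ hδ => by
        rw [hRe (hle hγ), hRe (hle hδ), hRe (mul_mem (hle hγ) (hle hδ)), ← map_mul]
        rfl
      eq_one := fun γ hγ => by
        rw [hRe (hcom hγ)]
        exact hone _ hγ }
  intro γ hγ
  have h := hR.eq_one_of_mem_congruence (containsElementary_commutator hl hN)
    (commutator_le_congruence N) hl (by nlinarith) hN.pow hγ
  rw [hRe (hle hγ)] at h
  exact hsub _ h

end Commutator

section Residue

variable {l : Type*} [DecidableEq l] [Fintype l] (N : ℕ)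

/-- The reduction modulo `N` of the matrix `X` with `γ = 1 + N X`. -/
def residue (γ : symplecticGroup l ℤ) : Matrix (l ⊕ l) (l ⊕ l) (ZMod N) :=
  (γ.1 - 1).map fun x => ((x / N : ℤ) : ZMod N)

variable {N}

theorem exists_eq_one_add_smul {γ : symplecticGroup l ℤ} (hγ : γ ∈ congruence l (N : ℤ)) :
    ∃ X, γ.1 = 1 + (N : ℤ) • X := by
  rw [mem_congruence_iff_entries] at hγ
  choose X hX using hγ
  refine ⟨Matrix.of X, ?_⟩
  rw [← sub_eq_iff_eq_add']
  ext x y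
  simpa using hX x y

theorem residue_eq (hN : N ≠ 0) {γ : symplecticGroup l ℤ} {X : Matrix (l ⊕ l) (l ⊕ l) ℤ}
    (hX : γ.1 = 1 + (N : ℤ) • X) : residue N γ = X.map (Int.castRingHom (ZMod N)) := by
  ext x y
  have : (N : ℤ) ≠ 0 := by exact_mod_cast hN
  simp only [residue, hX, add_sub_cancel_left, Matrix.map_apply, Matrix.smul_apply, smul_eq_mul,
    Int.mul_ediv_cancel_left _ this, eq_intCast]

theorem residue_mul (hN : N ≠ 0) {γ δ : symplecticGroup l ℤ} (hγ : γ ∈ congruence l (N : ℤ))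
    (hδ : δ ∈ congruence l (N : ℤ)) : residue N (γ * δ) = residue N γ + residue N δ := by
  obtain ⟨X, hX⟩ := exists_eq_one_add_smul hγ
  obtain ⟨Y, hY⟩ := exists_eq_one_add_smul hδ
  have e : (γ * δ).1 = 1 + (N : ℤ) • (X + Y + (N : ℤ) • (X * Y)) := by
    rw [Submonoid.coe_mul, hX, hY, Matrix.add_mul, Matrix.mul_add, Matrix.mul_add]
    simp only [Matrix.one_mul, Matrix.mul_one, Matrix.smul_mul, Matrix.mul_smul, smul_add]
    abel
  rw [residue_eq hN hX, residue_eq hN hY, residue_eq hN e]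
  ext x y
  simp only [Matrix.map_apply, Matrix.add_apply, Matrix.smul_apply, smul_eq_mul]
  simp

omit [Fintype l] in
theorem paperJ_map : (paperJ l ℤ).map (Int.castRingHom (ZMod N)) = paperJ l (ZMod N) := by
  rw [paperJ, paperJ, Matrix.fromBlocks_map]
  congr 1 <;> ext i j <;> by_cases h : i = j <;> simp [Matrix.one_apply, h]

theorem residue_mem_spLie (hN : N ≠ 0) {γ : symplecticGroup l ℤ}
    (hγ : γ ∈ congruence l (N : ℤ)) : residue N γ ∈ spLie l (ZMod N) := by
  obtain ⟨X, hX⟩ := exists_eq_one_add_smul hγ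
  have h := (mem_symplecticGroup_iff_paper γ.1).1 γ.2
  rw [hX] at h
  have h' : (N : ℤ) • (Xᵀ * paperJ l ℤ + paperJ l ℤ * X + (N : ℤ) • (Xᵀ * paperJ l ℤ * X)) =
      (N : ℤ) • 0 := by
    rw [smul_zero, ← sub_eq_zero.2 h]
    simp only [Matrix.transpose_add, Matrix.transpose_one, Matrix.transpose_smul, Matrix.add_mul,
      Matrix.mul_add, Matrix.one_mul, Matrix.mul_one, Matrix.smul_mul, Matrix.mul_smul, smul_add]
    abel
  have h0 := smul_right_injective _ (by exact_mod_cast hN : (N : ℤ) ≠ 0) h'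
  have h1 := congrArg (Int.castRingHom (ZMod N)).mapMatrix h0
  rw [residue_eq hN hX]
  change (X.map (Int.castRingHom (ZMod N)))ᵀ * paperJ l (ZMod N) + paperJ l (ZMod N) * _ = 0
  rw [← paperJ_map, ← Matrix.transpose_map, ← Matrix.map_mul, ← Matrix.map_mul]
  simp only [map_add, map_zero] at h1
  rw [← h1]
  simp only [RingHom.mapMatrix_apply, left_eq_add]
  ext x y
  simp only [Matrix.map_apply, Matrix.smul_apply, smul_eq_mul]
  simp

theorem residue_eq_zero_iff (hN : N ≠ 0) {γ : symplecticGroup l ℤ}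
    (hγ : γ ∈ congruence l (N : ℤ)) : residue N γ = 0 ↔ γ ∈ congruence l ((N : ℤ) ^ 2) := by
  obtain ⟨X, hX⟩ := exists_eq_one_add_smul hγ
  have hN' : (N : ℤ) ≠ 0 := by exact_mod_cast hN
  rw [residue_eq hN hX, mem_congruence_iff_entries, ← Matrix.ext_iff, hX]
  simp only [add_sub_cancel_left, Matrix.map_apply, Matrix.smul_apply, smul_eq_mul, sq,
    mul_dvd_mul_iff_left hN', Matrix.zero_apply, eq_intCast, ZMod.intCast_zmod_eq_zero_iff_dvd]

/-- The upper triangular unipotent symplectic matrix with symmetric block `B`. -/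
def upperUnipotent (B : Matrix l l ℤ) (hB : B.IsSymm) : symplecticGroup l ℤ :=
  ⟨fromBlocks 1 B 0 1, by
    rw [SymplecticGroup.mem_iff, J, fromBlocks_transpose, fromBlocks_multiply, fromBlocks_multiply]
    simp [hB.eq]⟩

/-- The lower triangular unipotent symplectic matrix with symmetric block `C`. -/
def lowerUnipotent (C : Matrix l l ℤ) (hC : C.IsSymm) : symplecticGroup l ℤ :=
  ⟨fromBlocks 1 0 C 1, by
    rw [SymplecticGroup.mem_iff, J, fromBlocks_transpose, fromBlocks_multiply, fromBlocks_multiply]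
    simp [hC.eq]⟩

theorem mem_congruence_of_eq {γ : symplecticGroup l ℤ} {X : Matrix (l ⊕ l) (l ⊕ l) ℤ}
    (hX : γ.1 = 1 + (N : ℤ) • X) : γ ∈ congruence l (N : ℤ) := by
  rw [mem_congruence_iff_entries, hX]
  simp only [add_sub_cancel_left, Matrix.smul_apply, smul_eq_mul, dvd_mul_right, implies_true]

/-- `residue` as a homomorphism on the principal congruence subgroup. -/
def residueHom (l : Type*) [DecidableEq l] [Fintype l] (hN : N ≠ 0) :
    congruence l (N : ℤ) →* Multiplicative (spLie l (ZMod N)) :=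
  .mk' (fun γ => .ofAdd ⟨residue N γ, residue_mem_spLie hN γ.2⟩) fun γ δ => by
    rw [← ofAdd_add]
    congr 1
    exact Subtype.ext (residue_mul hN γ.2 δ.2)

/-- The set of residues, as an additive subgroup. -/
def residues (l : Type*) [DecidableEq l] [Fintype l] (hN : N ≠ 0) :
    AddSubgroup (Matrix (l ⊕ l) (l ⊕ l) (ZMod N)) :=
  (residueHom l hN).range.toAddSubgroup'.map (spLie l (ZMod N)).toAddSubgroup.subtype

theorem mem_residues_of_eq (hN : N ≠ 0) {γ : symplecticGroup l ℤ} {X : Matrix (l ⊕ l) (l ⊕ l) ℤ}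
    (hX : γ.1 = 1 + (N : ℤ) • X) : X.map (Int.castRingHom (ZMod N)) ∈ residues l hN := by
  rw [← residue_eq hN hX]
  exact ⟨_, ⟨⟨γ, mem_congruence_of_eq hX⟩, rfl⟩, rfl⟩

omit [Fintype l] in
theorem fromBlocks_eq_one_add_smul (A B C D : Matrix l l ℤ) :
    fromBlocks (1 + (N : ℤ) • A) ((N : ℤ) • B) ((N : ℤ) • C) (1 + (N : ℤ) • D) =
      1 + (N : ℤ) • fromBlocks A B C D := by
  rw [← fromBlocks_one, fromBlocks_smul, fromBlocks_add, zero_add, zero_add]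

theorem fromBlocks_upper_mem_residues (hN : N ≠ 0) {B : Matrix l l ℤ} (hB : B.IsSymm) :
    fromBlocks 0 (B.map (Int.castRingHom (ZMod N))) 0 0 ∈ residues l hN := by
  have := mem_residues_of_eq hN (γ := upperUnipotent ((N : ℤ) • B) (hB.smul _))
    (X := fromBlocks 0 B 0 0) (by
      rw [← fromBlocks_eq_one_add_smul, smul_zero, add_zero]; rfl)
  simpa [fromBlocks_map] using this

theorem fromBlocks_lower_mem_residues (hN : N ≠ 0) {C : Matrix l l ℤ} (hC : C.IsSymm) :
    fromBlocks 0 0 (C.map (Int.castRingHom (ZMod N))) 0 ∈ residues l hN := by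
  have := mem_residues_of_eq hN (γ := lowerUnipotent ((N : ℤ) • C) (hC.smul _))
    (X := fromBlocks 0 0 C 0) (by
      rw [← fromBlocks_eq_one_add_smul, smul_zero, add_zero]; rfl)
  simpa [fromBlocks_map] using this

theorem fromBlocks_mul_mem_residues (hN : N ≠ 0) {T C : Matrix l l ℤ} (hT : T.IsSymm)
    (hC : C.IsSymm) : fromBlocks ((T * C).map (Int.castRingHom (ZMod N))) 0 0
      (-((T * C).map (Int.castRingHom (ZMod N)))ᵀ) ∈ residues l hN := by
  have h1 := mem_residues_of_eq hN (γ := upperUnipotent T hT *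
    lowerUnipotent ((N : ℤ) • C) (hC.smul _) * upperUnipotent (-T) hT.neg)
    (X := fromBlocks (T * C) (-(T * C * T)) C (-(C * T))) (by
      rw [← fromBlocks_eq_one_add_smul]
      simp only [upperUnipotent, lowerUnipotent, Submonoid.coe_mul, fromBlocks_multiply]
      simp only [Matrix.one_mul, Matrix.mul_one, Matrix.mul_zero, Matrix.smul_mul,
        Matrix.mul_smul, Matrix.mul_neg, Matrix.add_mul, add_zero, zero_add, smul_neg]
      congr 1 <;> abel)
  have hTCT : (-(T * C * T)).IsSymm := by
    simp [Matrix.IsSymm, hT.eq, hC.eq, Matrix.mul_assoc]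
  have h2 := fromBlocks_upper_mem_residues hN hTCT
  have h3 := fromBlocks_lower_mem_residues hN hC
  have h4 := sub_mem (sub_mem h1 h2) h3
  have e : (T * C)ᵀ = C * T := by rw [Matrix.transpose_mul, hT.eq, hC.eq]
  convert h4 using 1
  rw [← Matrix.transpose_map, e, fromBlocks_map, sub_eq_add_neg, sub_eq_add_neg, fromBlocks_neg,
    fromBlocks_neg, fromBlocks_add, fromBlocks_add]
  congr 1
  · simp
  · simp
  · simp
  · ext x y; simp

theorem fromBlocks_diag_mem_residues (hN : N ≠ 0) (A : Matrix l l (ZMod N)) :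
    fromBlocks A 0 0 (-Aᵀ) ∈ residues l hN := by
  let f : Matrix l l (ZMod N) →+ Matrix (l ⊕ l) (l ⊕ l) (ZMod N) :=
    { toFun := fun A => fromBlocks A 0 0 (-Aᵀ)
      map_zero' := by simp
      map_add' := fun A B => by
        rw [fromBlocks_add]; simp [add_comm] }
  change A ∈ (residues l hN).comap f
  rw [matrix_eq_sum_single A]
  refine sum_mem fun i _ => sum_mem fun j _ => ?_
  obtain ⟨c, hc⟩ := ZMod.intCast_surjective (A i j)
  change fromBlocks (single i j (A i j)) 0 0 (-(single i j (A i j))ᵀ) ∈ residues l hN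
  obtain ⟨C, hC, e⟩ : ∃ C : Matrix l l ℤ, C.IsSymm ∧ single i i 1 * C = single i j c := by
    by_cases hij : i = j
    · subst hij
      exact ⟨single i i c, by simp [Matrix.IsSymm], by simp⟩
    · exact ⟨single i j c + single j i c, by simp [Matrix.IsSymm, add_comm],
        by rw [Matrix.mul_add]; simp [hij]⟩
  have := fromBlocks_mul_mem_residues hN (T := single i i 1) (by simp [Matrix.IsSymm]) hC
  have hs : (single i j c).map (Int.castRingHom (ZMod N)) = single i j (A i j) := by
    rw [Matrix.map_single, eq_intCast, hc]
  rwa [e, hs] at this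

theorem mem_residues (hN : N ≠ 0) {X : Matrix (l ⊕ l) (l ⊕ l) (ZMod N)}
    (hX : X ∈ spLie l (ZMod N)) : X ∈ residues l hN := by
  have hlift : ∀ B : Matrix l l (ZMod N), B.IsSymm →
      ∃ B' : Matrix l l ℤ, B'.IsSymm ∧ B'.map (Int.castRingHom (ZMod N)) = B := by
    intro B hB
    choose f hf using ZMod.intCast_surjective (n := N)
    exact ⟨B.map f, hB.map f, by ext; simp [hf]⟩
  obtain ⟨A, B, C, D, rfl⟩ : ∃ A B C D, X = fromBlocks A B C D :=
    ⟨_, _, _, _, (fromBlocks_toBlocks X).symm⟩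
  change _ + _ = _ at hX
  rw [paperJ, fromBlocks_transpose, fromBlocks_multiply, fromBlocks_multiply, fromBlocks_add,
    ← fromBlocks_zero, fromBlocks_inj] at hX
  obtain ⟨h1, h2, h3, h4⟩ := hX
  simp only [Matrix.mul_zero, Matrix.zero_mul, Matrix.mul_one, Matrix.one_mul, Matrix.mul_neg,
    Matrix.neg_mul, add_zero, zero_add] at h1 h2 h3 h4
  obtain ⟨B', hB', rfl⟩ := hlift B (add_neg_eq_zero.1 h4)
  obtain ⟨C', hC', rfl⟩ := hlift C (neg_add_eq_zero.1 h1)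
  have hD : D = -Aᵀ := eq_neg_of_add_eq_zero_right h2
  have := add_mem (add_mem (fromBlocks_diag_mem_residues hN A)
    (fromBlocks_upper_mem_residues hN hB')) (fromBlocks_lower_mem_residues hN hC')
  rw [hD]
  simpa [fromBlocks_add] using this

theorem residueHom_surjective (hN : N ≠ 0) : Function.Surjective (residueHom l hN) := by
  intro X
  obtain ⟨Y, ⟨γ, hγ⟩, e⟩ := mem_residues hN X.toAdd.2
  exact ⟨γ, hγ.trans (Subtype.ext e)⟩

theorem ker_residueHom (hl : 3 ≤ Fintype.card l) (hN : 1 < N) (hNo : Odd N) :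
    (residueHom l (by omega : N ≠ 0)).ker = commutator (congruence l (N : ℤ)) := by
  refine le_antisymm (fun γ hγ => ?_) (Abelianization.commutator_subset_ker _)
  have h0 : residue N γ.1 = 0 := congrArg (fun X => X.toAdd.1) hγ
  have h := congruence_sq_le_commutator hl (by exact_mod_cast hNo) (by exact_mod_cast hN)
    ((residue_eq_zero_iff (by omega) γ.2).1 h0)
  rw [← Subgroup.map_subtype_commutator] at h
  obtain ⟨δ, hδ, e⟩ := h
  rwa [← Subtype.ext e]

end Residue

theorem ker_spIntRed (g N : ℕ) : (spIntRed g N).ker = congruence (Fin g) (N : ℤ) := by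
  ext γ
  rw [MonoidHom.mem_ker, mem_congruence_iff_entries, Subtype.ext_iff, ← Matrix.ext_iff]
  refine forall₂_congr fun x y => ?_
  rw [← ZMod.intCast_zmod_eq_zero_iff_dvd, Matrix.sub_apply, Int.cast_sub, sub_eq_zero]
  change ((γ.1 x y : ℤ) : ZMod N) = _ ↔ _
  by_cases h : x = y <;> simp [Matrix.one_apply, h]

end SymplecticGroup

/-- Let `g ≥ 3` and `N ≥ 3` odd, and let `Γ_g(N)` be the principal
congruence subgroup of level `N`, the kernel of the reduction `Sp_{2g}(ℤ) → Sp_{2g}(ℤ/Nℤ)`.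
Then the abelianization of `Γ_g(N)` is isomorphic as a group to the additive group
`sp_{2g}(ℤ/Nℤ)`. -/
theorem abelianization_congruence_subgroup (g N : ℕ) (hg : 3 ≤ g) (hN : 3 ≤ N)
    (hNodd : Odd N) :
    Nonempty (Additive (Abelianization ↥((spIntRed g N).ker)) ≃+ ↥(spLie (Fin g) (ZMod N))) := by
  rw [SymplecticGroup.ker_spIntRed]
  have hker := SymplecticGroup.ker_residueHom (l := Fin g) (by simpa using hg)
    (by omega : 1 < N) hNodd
  exact ⟨MulEquiv.toAdditiveLeft ((QuotientGroup.quotientMulEquivOfEq hker.symm).trans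
    (QuotientGroup.quotientKerEquivOfSurjective _ (SymplecticGroup.residueHom_surjective _)))⟩
end

section
/- Let g ≥ 3 and let N ≥ 1 be odd, and let Γ_g(N) ⊆ Sp_{2g}(ℤ) be the principal congruence subgroup of level N (the kernel of reduction modulo N). Then the restriction map on degree-2 group cohomology with trivial integer coefficients, res : H²(Sp_{2g}(ℤ), ℤ) → H²(Γ_g(N), ℤ), is injective. -/
open Matrix

/-- A cocycle that becomes a coboundary on a subgroup of finite index `m` becomes one after
multiplication by `m`. -/
theorem exists_index_mul_eq_coboundary {G : Type*} [Group G] (H : Subgroup G) [H.FiniteIndex]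
    (f : G → G → ℤ) (hf : ∀ a b c, f a b + f (a * b) c = f b c + f a (b * c))
    (φ : H → ℤ) (hφ : ∀ a b : H, f a b = φ a + φ b - φ (a * b)) :
    ∃ β : G → ℤ, ∀ a b, (H.index : ℤ) * f a b = β a + β b - β (a * b) := by
  classical
  -- a cochain `F` on `G` that trivializes `f` on `G × H`
  obtain ⟨F, hF⟩ : ∃ F : G → ℤ, ∀ (x : G) (h : H), f x h = F x + φ h - F (x * h) := by
    let r : G → G := fun x => (QuotientGroup.mk x : G ⧸ H).out
    have hr : ∀ x, (r x)⁻¹ * x ∈ H := fun x =>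
      QuotientGroup.eq.mp (QuotientGroup.out_eq' (QuotientGroup.mk x : G ⧸ H))
    refine ⟨fun x => φ ⟨(r x)⁻¹ * x, hr x⟩ - f (r x) ((r x)⁻¹ * x), fun x h => ?_⟩
    have hrh : r (x * h) = r x := by
      simp only [r, QuotientGroup.mk_mul_of_mem x h.2]
    have hcoc := hf (r x) ((r x)⁻¹ * x) h
    have hadd := hφ ⟨(r x)⁻¹ * x, hr x⟩ h
    have hmul : φ ⟨(r (x * h))⁻¹ * (x * h), hr (x * h)⟩ = φ (⟨(r x)⁻¹ * x, hr x⟩ * h) := by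
      congr 1
      ext
      simp [hrh, mul_assoc]
    rw [mul_inv_cancel_left] at hcoc
    simp only [hrh, mul_assoc] at hcoc hadd hmul ⊢
    linarith
  have hdesc : ∀ x : G, ∃ u : G ⧸ H → ℤ, ∀ y : G, u y = f x y - F y + F (x * y) := by
    refine fun x => ⟨Quotient.lift (fun y => f x y - F y + F (x * y)) ?_, fun y => rfl⟩
    intro y z hyz
    obtain ⟨h, rfl⟩ : ∃ h : H, z = y * h :=
      ⟨⟨y⁻¹ * z, QuotientGroup.leftRel_apply.mp hyz⟩, by simp⟩
    have hcoc := hf x y h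
    have h₁ := hF y h
    have h₂ := hF (x * y) h
    simp only [mul_assoc] at hcoc h₂ ⊢
    linarith
  choose u hu using hdesc
  have := H.fintypeQuotientOfFiniteIndex
  refine ⟨fun x => ∑ q, u x q, fun a b => ?_⟩
  have hpoint : ∀ q : G ⧸ H, f a b + u (a * b) q = u b q + u a (b • q) := by
    intro q
    induction q using QuotientGroup.induction_on with
    | H y =>
      rw [MulAction.Quotient.smul_coe, smul_eq_mul, hu, hu, hu]
      have hcoc := hf a b y
      simp only [mul_assoc] at hcoc ⊢
      linarith
  have hsum := Finset.sum_congr (rfl : (Finset.univ : Finset (G ⧸ H)) = _) fun q _ => hpoint q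
  have hperm : ∑ q, u a (b • q) = ∑ q, u a q := Equiv.sum_comp (MulAction.toPerm b) (u a)
  rw [Finset.sum_add_distrib, Finset.sum_add_distrib, hperm, Finset.sum_const, Finset.card_univ,
    ← Nat.card_eq_fintype_card, nsmul_eq_mul] at hsum
  rw [Subgroup.index]
  linarith

/-- Over a group without nontrivial characters of order dividing `m`, a `2`-cochain is a coboundary
as soon as its multiple by `m` is one. -/
theorem exists_eq_coboundary_of_mul_eq_coboundary {G : Type*} [Group G]
    (m : ℕ) (hm : m ≠ 0) (hG : ∀ χ : G →* Multiplicative (ZMod m), χ = 1)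
    (f : G → G → ℤ) (β : G → ℤ) (hβ : ∀ a b, (m : ℤ) * f a b = β a + β b - β (a * b)) :
    ∃ ψ : G → ℤ, ∀ a b, f a b = ψ a + ψ b - ψ (a * b) := by
  let χ : G →* Multiplicative (ZMod m) := MonoidHom.mk' (fun a => .ofAdd (β a : ZMod m)) <| by
    intro a b
    have h := congrArg (Int.cast : ℤ → ZMod m) (hβ a b)
    push_cast at h
    rw [ZMod.natCast_self, zero_mul] at h
    rw [← ofAdd_add]
    exact congrArg _ (sub_eq_zero.mp h.symm).symm
  have hdvd : ∀ a, (m : ℤ) ∣ β a := fun a =>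
    (ZMod.intCast_zmod_eq_zero_iff_dvd (β a) m).mp
      (Multiplicative.ofAdd.injective (DFunLike.congr_fun (hG χ) a))
  choose ψ hψ using hdvd
  refine ⟨ψ, fun a b => mul_left_cancel₀ (Nat.cast_ne_zero.mpr hm : (m : ℤ) ≠ 0) ?_⟩
  rw [hβ, hψ a, hψ b, hψ (a * b)]
  ring

namespace SymplecticGroup

variable {l : Type*}

theorem swap_elim (s : l ⊕ l) : s.swap.elim id id = s.elim id id := by
  rcases s with i | i <;> rfl

/-- Vectors of `ℤ²ᵍ` supported off the planes indexed by `S`. -/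
def SupportedOff (S : Set l) (u : l ⊕ l → ℤ) : Prop :=
  ∀ i ∈ S, u (.inl i) = 0 ∧ u (.inr i) = 0

theorem SupportedOff.add {S : Set l} {u v : l ⊕ l → ℤ} (hu : SupportedOff S u)
    (hv : SupportedOff S v) : SupportedOff S (u + v) := fun i hi => by
  simp [hu i hi, hv i hi]

theorem SupportedOff.notMem {S : Set l} {u : l ⊕ l → ℤ} (hu : SupportedOff S u) {s : l ⊕ l}
    (hs : u s ≠ 0) : s.elim id id ∉ S := by
  rcases s with i | i
  exacts [fun hi => hs (hu i hi).1, fun hi => hs (hu i hi).2]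

/-- Vectors supported off the planes indexed by `S` with a coordinate equal to `1` or `-1`. -/
def HasUnitCoord (S : Set l) (u : l ⊕ l → ℤ) : Prop :=
  SupportedOff S u ∧ ∃ s, IsUnit (u s)

variable [DecidableEq l]

/-- The standard basis vectors of `ℤ²ᵍ`. -/
abbrev basisVec (s : l ⊕ l) : l ⊕ l → ℤ := Pi.single s 1

theorem supportedOff_basisVec {S : Set l} {s : l ⊕ l} (hs : s.elim id id ∉ S) :
    SupportedOff S (basisVec s) := by
  rintro i hi
  constructor <;> refine Pi.single_eq_of_ne ?_ _ <;> rintro rfl <;> exact hs hi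

theorem hasUnitCoord_basisVec {S : Set l} {s : l ⊕ l} (hs : s.elim id id ∉ S) :
    HasUnitCoord S (basisVec s) :=
  ⟨supportedOff_basisVec hs, s, by simp⟩

variable [Fintype l]

/-- The alternating form on `ℤ²ᵍ` with matrix `Matrix.J`. -/
def form (x y : l ⊕ l → ℤ) : ℤ := x ⬝ᵥ J l ℤ *ᵥ y

theorem form_add_left (x y z : l ⊕ l → ℤ) : form (x + y) z = form x z + form y z := by
  simp [form, add_dotProduct]

theorem form_add_right (x y z : l ⊕ l → ℤ) : form x (y + z) = form x y + form x z := by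
  simp [form, mulVec_add, dotProduct_add]

theorem form_smul_left (k : ℤ) (x y : l ⊕ l → ℤ) : form (k • x) y = k * form x y := by
  simp [form, smul_dotProduct, -zsmul_eq_mul]

theorem form_smul_right (k : ℤ) (x y : l ⊕ l → ℤ) : form x (k • y) = k * form x y := by
  simp [form, mulVec_smul, dotProduct_smul, -zsmul_eq_mul]

theorem form_eq_neg (x y : l ⊕ l → ℤ) : form x y = -form y x := by
  rw [form, form, dotProduct_mulVec, dotProduct_comm, ← mulVec_transpose, J_transpose, neg_mulVec,
    dotProduct_neg]

theorem form_self (x : l ⊕ l → ℤ) : form x x = 0 := by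
  have := form_eq_neg x x
  omega

theorem form_mulVec_mulVec (M : Matrix (l ⊕ l) (l ⊕ l) ℤ) (x y : l ⊕ l → ℤ) :
    form (M *ᵥ x) (M *ᵥ y) = x ⬝ᵥ (Mᵀ * J l ℤ * M) *ᵥ y := by
  rw [form, mul_assoc, ← mulVec_mulVec, ← mulVec_mulVec, dotProduct_mulVec x, vecMul_transpose]

theorem form_coe_mulVec (M : symplecticGroup l ℤ) (x y : l ⊕ l → ℤ) :
    form (M.1 *ᵥ x) (M.1 *ᵥ y) = form x y := by
  rw [form_mulVec_mulVec, mem_iff'.mp M.2, form]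

theorem mem_of_form_mulVec_mulVec (M : Matrix (l ⊕ l) (l ⊕ l) ℤ)
    (h : ∀ x y, form (M *ᵥ x) (M *ᵥ y) = form x y) : M ∈ symplecticGroup l ℤ := by
  rw [mem_iff']
  ext s t
  have := h (Pi.single s 1) (Pi.single t 1)
  rw [form_mulVec_mulVec, form] at this
  simpa using this

theorem ext_mulVec {X Y : symplecticGroup l ℤ} (h : ∀ x, X.1 *ᵥ x = Y.1 *ᵥ x) : X = Y :=
  Subtype.ext (Matrix.ext_of_mulVec_single fun _ => h _)

theorem coe_mul_mulVec (X Y : symplecticGroup l ℤ) (x : l ⊕ l → ℤ) :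
    (X * Y).1 *ᵥ x = X.1 *ᵥ (Y.1 *ᵥ x) := by
  rw [Submonoid.coe_mul, mulVec_mulVec]

theorem form_basisVec_inl (x : l ⊕ l → ℤ) (i : l) : form x (basisVec (.inl i)) = x (.inr i) := by
  simp [form, J, dotProduct, Matrix.one_apply]

theorem form_basisVec_inr (x : l ⊕ l → ℤ) (i : l) : form x (basisVec (.inr i)) = -x (.inl i) := by
  simp [form, J, dotProduct, Matrix.one_apply]

theorem form_basisVec_eq_or (x : l ⊕ l → ℤ) (s : l ⊕ l) :
    form x (basisVec s) = x s.swap ∨ form x (basisVec s) = -x s.swap := by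
  rcases s with i | i
  · exact .inl (form_basisVec_inl x i)
  · exact .inr (form_basisVec_inr x i)

theorem mulVec_one_add_smul_vecMulVec (k : ℤ) (u x : l ⊕ l → ℤ) :
    (1 + k • vecMulVec u (J l ℤ *ᵥ u)) *ᵥ x = x + (k * form x u) • u := by
  simp [add_mulVec, smul_mulVec, vecMulVec_mulVec, form, dotProduct_comm x, mul_smul,
    -zsmul_eq_mul]

/-- The symplectic transvection `x ↦ x + k ⟨x, u⟩ u`. -/
def transvection (k : ℤ) (u : l ⊕ l → ℤ) : symplecticGroup l ℤ :=
  ⟨1 + k • vecMulVec u (J l ℤ *ᵥ u), mem_of_form_mulVec_mulVec _ fun x y => by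
    simp only [mulVec_one_add_smul_vecMulVec, form_add_left, form_add_right, form_smul_left,
      form_smul_right, form_self, form_eq_neg u y]
    ring⟩

theorem transvection_mulVec (k : ℤ) (u x : l ⊕ l → ℤ) :
    (transvection k u).1 *ᵥ x = x + (k * form x u) • u :=
  mulVec_one_add_smul_vecMulVec k u x

theorem mul_transvection (X : symplecticGroup l ℤ) (k : ℤ) (u : l ⊕ l → ℤ) :
    X * transvection k u = transvection k (X.1 *ᵥ u) * X := by
  refine ext_mulVec fun x => ?_
  rw [coe_mul_mulVec, coe_mul_mulVec, transvection_mulVec, transvection_mulVec, mulVec_add,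
    mulVec_smul, form_coe_mulVec]

/-- For pairwise orthogonal vectors, transvections behave like a quadratic form. -/
theorem transvection_add_add (k : ℤ) (a b c : l ⊕ l → ℤ) (hab : form a b = 0) (hac : form a c = 0)
    (hbc : form b c = 0) :
    transvection k (a + b + c) * transvection k a * transvection k b * transvection k c =
      transvection k (a + b) * transvection k (a + c) * transvection k (b + c) := by
  have hba : form b a = 0 := by rw [form_eq_neg, hab, neg_zero]
  have hca : form c a = 0 := by rw [form_eq_neg, hac, neg_zero]
  have hcb : form c b = 0 := by rw [form_eq_neg, hbc, neg_zero]
  refine ext_mulVec fun x => ?_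
  simp only [coe_mul_mulVec, transvection_mulVec, form_add_left, form_add_right, form_smul_left,
    form_self, hab, hac, hbc, hba, hca, hcb]
  module

/-- The symplectic matrices that fix the planes indexed by `S` pointwise. -/
def fixing (S : Set l) : Subgroup (symplecticGroup l ℤ) where
  carrier := {X | ∀ s : l ⊕ l, s.elim id id ∈ S → X.1 *ᵥ basisVec s = basisVec s}
  mul_mem' {X Y} hX hY s hs := by rw [coe_mul_mulVec, hY s hs, hX s hs]
  one_mem' s _ := one_mulVec _
  inv_mem' {X} hX s hs := by
    conv_lhs => rw [← hX s hs, ← coe_mul_mulVec, inv_mul_cancel]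
    exact one_mulVec _

theorem supportedOff_iff (S : Set l) (u : l ⊕ l → ℤ) :
    SupportedOff S u ↔ ∀ s : l ⊕ l, s.elim id id ∈ S → form u (basisVec s) = 0 := by
  simp [SupportedOff, form_basisVec_inl, form_basisVec_inr, forall_and, and_comm]

theorem transvection_mem_fixing {S : Set l} {u : l ⊕ l → ℤ} (hu : SupportedOff S u) (k : ℤ) :
    transvection k u ∈ fixing S := by
  intro s hs
  rw [transvection_mulVec, form_eq_neg, (supportedOff_iff S u).mp hu s hs]
  simp

theorem SupportedOff.mulVec {S : Set l} {u : l ⊕ l → ℤ} (hu : SupportedOff S u)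
    {X : symplecticGroup l ℤ} (hX : X ∈ fixing S) : SupportedOff S (X.1 *ᵥ u) := by
  rw [supportedOff_iff] at hu ⊢
  intro s hs
  rw [← hX s hs, form_coe_mulVec, hu s hs]

theorem exists_mem_mulVec_eq_of_isUnit_form {H : Subgroup (symplecticGroup l ℤ)}
    {a b : l ⊕ l → ℤ} (ha : ∀ k, transvection k a ∈ H) (hb : ∀ k, transvection k b ∈ H)
    (hab : IsUnit (form a b)) : ∃ X ∈ H, X.1 *ᵥ a = b := by
  refine ⟨_, H.mul_mem (ha (form a b)) (hb (form a b)), ?_⟩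
  rw [coe_mul_mulVec, transvection_mulVec, transvection_mulVec, Int.isUnit_mul_self hab,
    form_add_left, form_self, form_smul_left, form_eq_neg b a, zero_add, one_mul, mul_neg,
    Int.isUnit_mul_self hab]
  module

theorem isUnit_form_basisVec {u : l ⊕ l → ℤ} {s : l ⊕ l} (hs : IsUnit (u s.swap)) :
    IsUnit (form u (basisVec s)) := by
  rcases form_basisVec_eq_or u s with h | h <;> rw [h]
  exacts [hs, hs.neg]

/-- A group containing the transvections along all vectors with a unit coordinate acts
transitively on these vectors. -/
theorem exists_mem_mulVec_eq {S : Set l} {H : Subgroup (symplecticGroup l ℤ)}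
    (hH : ∀ u, HasUnitCoord S u → ∀ k, transvection k u ∈ H) {u v : l ⊕ l → ℤ}
    (hu : HasUnitCoord S u) (hv : HasUnitCoord S v) : ∃ X ∈ H, X.1 *ᵥ u = v := by
  have hsymm : ∀ {a b : l ⊕ l → ℤ}, (∃ X ∈ H, X.1 *ᵥ a = b) → ∃ X ∈ H, X.1 *ᵥ b = a := by
    rintro a _ ⟨X, hX, rfl⟩
    refine ⟨X⁻¹, H.inv_mem hX, ?_⟩
    rw [← coe_mul_mulVec, inv_mul_cancel]
    exact one_mulVec a
  have htrans : ∀ {a b c : l ⊕ l → ℤ}, (∃ X ∈ H, X.1 *ᵥ a = b) → (∃ X ∈ H, X.1 *ᵥ b = c) →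
      ∃ X ∈ H, X.1 *ᵥ a = c := by
    rintro a _ _ ⟨X, hX, rfl⟩ ⟨Y, hY, rfl⟩
    exact ⟨Y * X, H.mul_mem hY hX, coe_mul_mulVec Y X a⟩
  have hlink : ∀ {a b : l ⊕ l → ℤ}, HasUnitCoord S a → HasUnitCoord S b → IsUnit (form a b) →
      ∃ X ∈ H, X.1 *ᵥ a = b := fun ha hb =>
    exists_mem_mulVec_eq_of_isUnit_form (hH _ ha) (hH _ hb)
  have hbasis : ∀ {a : l ⊕ l → ℤ}, HasUnitCoord S a → ∀ s, IsUnit (a s) →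
      s.elim id id ∉ S ∧ ∃ X ∈ H, X.1 *ᵥ a = basisVec s.swap := by
    intro a ha s hs
    have hsS := ha.1.notMem hs.ne_zero
    refine ⟨hsS, hlink ha (hasUnitCoord_basisVec (by rwa [swap_elim])) (isUnit_form_basisVec ?_)⟩
    rwa [Sum.swap_swap]
  obtain ⟨s, hs⟩ := hu.2
  obtain ⟨t, ht⟩ := hv.2
  obtain ⟨hsS, hus⟩ := hbasis hu s hs
  obtain ⟨htS, hvt⟩ := hbasis hv t ht
  refine htrans hus (htrans ?_ (hsymm hvt))
  by_cases hst : s = t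
  · subst hst
    exact ⟨1, H.one_mem, one_mulVec _⟩
  have hc : SupportedOff S (basisVec s + basisVec t) :=
    (supportedOff_basisVec hsS).add (supportedOff_basisVec htS)
  have hcs : IsUnit ((basisVec s + basisVec t) s) := by simp [hst]
  have hct : IsUnit ((basisVec s + basisVec t) t) := by simp [Ne.symm hst]
  exact htrans (hsymm (hbasis ⟨hc, s, hcs⟩ s hcs).2) (hbasis ⟨hc, s, hcs⟩ t hct).2

theorem map_transvection_eq_one (hl : 3 ≤ Fintype.card l) {A : Type*} [CommGroup A]
    (χ : symplecticGroup l ℤ →* A) {u : l ⊕ l → ℤ} (hu : HasUnitCoord ∅ u) (k : ℤ) :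
    χ (transvection k u) = 1 := by
  have hconj : ∀ v, HasUnitCoord ∅ v → χ (transvection k v) = χ (transvection k u) := by
    intro v hv
    obtain ⟨X, -, rfl⟩ := exists_mem_mulVec_eq (H := ⊤) (fun _ _ _ => Subgroup.mem_top _) hu hv
    have := congrArg χ (mul_transvection X k u)
    rw [map_mul, map_mul, mul_comm] at this
    exact (mul_right_cancel this).symm
  obtain ⟨i, j, m, hij, him, hjm⟩ := Fintype.two_lt_card_iff.mp hl
  have hrel := congrArg χ (transvection_add_add k (basisVec (.inl i)) (basisVec (.inl j))
    (basisVec (.inl m)) (by simp [form_basisVec_inl]) (by simp [form_basisVec_inl])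
    (by simp [form_basisVec_inl]))
  have hunit : ∀ (v : l ⊕ l → ℤ) (s : l ⊕ l), v s = 1 → HasUnitCoord ∅ v := fun v s hs =>
    ⟨fun _ h => h.elim, s, by simp [hs]⟩
  simp only [map_mul] at hrel
  rw [hconj (basisVec (.inl i) + basisVec (.inl j) + basisVec (.inl m))
      (hunit _ (.inl i) (by simp [hij, him])),
    hconj (basisVec (.inl i)) (hunit _ (.inl i) (by simp)),
    hconj (basisVec (.inl j)) (hunit _ (.inl j) (by simp)),
    hconj (basisVec (.inl m)) (hunit _ (.inl m) (by simp)),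
    hconj (basisVec (.inl i) + basisVec (.inl j)) (hunit _ (.inl i) (by simp [hij])),
    hconj (basisVec (.inl i) + basisVec (.inl m)) (hunit _ (.inl i) (by simp [him])),
    hconj (basisVec (.inl j) + basisVec (.inl m)) (hunit _ (.inl j) (by simp [hjm]))] at hrel
  exact mul_eq_left.mp hrel

/-- Elementary operation: add a multiple of one coordinate to another. -/
theorem exists_mem_mulVec_eq_add_smul {S : Set l} {H : Subgroup (symplecticGroup l ℤ)}
    (hH : ∀ u, HasUnitCoord S u → ∀ k, transvection k u ∈ H) {v : l ⊕ l → ℤ} {s t : l ⊕ l}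
    (hs : s.elim id id ∉ S) (ht : t.elim id id ∉ S) (hst : s ≠ t)
    (h : t = s.swap ∨ v s.swap = 0) (k : ℤ) :
    ∃ X ∈ H, X.1 *ᵥ v = v + (k * v t) • basisVec s := by
  by_cases hts : t = s.swap
  · subst hts
    rcases form_basisVec_eq_or v s with hf | hf
    · refine ⟨_, hH _ (hasUnitCoord_basisVec hs) k, ?_⟩
      rw [transvection_mulVec, hf]
    · refine ⟨_, hH _ (hasUnitCoord_basisVec hs) (-k), ?_⟩
      rw [transvection_mulVec, hf, neg_mul_neg]
  have hvs : form v (basisVec s) = 0 := by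
    have := h.resolve_left hts
    rcases form_basisVec_eq_or v s with hf | hf <;> simp [hf, this]
  have ht' : t.swap.elim id id ∉ S := by rwa [swap_elim]
  have hort : form (basisVec s) (basisVec t.swap) = 0 := by
    rcases form_basisVec_eq_or (basisVec s) t.swap with hf | hf <;> simp [hf, Ne.symm hst]
  have hort' : form (basisVec t.swap) (basisVec s) = 0 := by rw [form_eq_neg, hort, neg_zero]
  have hsum : HasUnitCoord S (basisVec s + basisVec t.swap) := by
    refine ⟨(supportedOff_basisVec hs).add (supportedOff_basisVec ht'), s, ?_⟩
    have : s ≠ t.swap := by rintro rfl; simp at hts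
    simp [this]
  have key : ∀ k : ℤ, ∃ X ∈ H,
      X.1 *ᵥ v = v + (k * form v (basisVec t.swap)) • basisVec s := by
    intro k
    refine ⟨_, H.mul_mem (H.mul_mem (hH _ hsum k) (hH _ (hasUnitCoord_basisVec hs) (-k)))
      (hH _ (hasUnitCoord_basisVec ht') (-k)), ?_⟩
    simp only [coe_mul_mulVec, transvection_mulVec, form_add_left, form_add_right, form_smul_left,
      form_self, hort, hort', hvs]
    module
  rcases form_basisVec_eq_or v t.swap with hf | hf
  · simpa [hf] using key k
  · simpa [hf] using key (-k)

theorem exists_mem_hasUnitCoord_mulVec {S : Set l} {H : Subgroup (symplecticGroup l ℤ)}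
    (hH : ∀ u, HasUnitCoord S u → ∀ k, transvection k u ∈ H) (hHS : H ≤ fixing S)
    {v : l ⊕ l → ℤ} (hv : SupportedOff S v) {w : l ⊕ l → ℤ} (hvw : IsUnit (form v w)) :
    ∃ X ∈ H, HasUnitCoord S (X.1 *ᵥ v) := by
  induction hn : ∑ s, (v s).natAbs using Nat.strong_induction_on generalizing v w with
  | _ n ih =>
  subst hn
  -- an admissible pair of nonzero coordinates allows a decrease
  have hred : ∀ s t : l ⊕ l, s ≠ t → v s ≠ 0 → v t ≠ 0 → (t = s.swap ∨ v s.swap = 0) →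
      (v t).natAbs ≤ (v s).natAbs → ∃ X ∈ H, HasUnitCoord S (X.1 *ᵥ v) := by
    intro s t hst hs ht hadm hle
    obtain ⟨k, hk⟩ : ∃ k : ℤ, (v s + k * v t).natAbs < (v s).natAbs := by
      by_cases hsign : (v s + 1 * v t).natAbs < (v s).natAbs
      · exact ⟨1, hsign⟩
      · exact ⟨-1, by omega⟩
    obtain ⟨X, hX, hXv⟩ := exists_mem_mulVec_eq_add_smul hH (hv.notMem hs) (hv.notMem ht) hst
      hadm k
    have hlt : ∑ r, ((X.1 *ᵥ v) r).natAbs < ∑ r, (v r).natAbs := by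
      refine Finset.sum_lt_sum (fun r _ => ?_) ⟨s, Finset.mem_univ s, ?_⟩
      · by_cases hr : r = s
        · subst hr
          simpa [hXv] using hk.le
        · simp [hXv, hr]
      · simpa [hXv] using hk
    obtain ⟨Y, hY, hYv⟩ := ih _ hlt (hv.mulVec (hHS hX)) (w := X.1 *ᵥ w)
      (by rwa [form_coe_mulVec]) rfl
    exact ⟨Y * X, H.mul_mem hY hX, by rwa [coe_mul_mulVec]⟩
  have hpair : ∀ s t : l ⊕ l, s ≠ t → v s ≠ 0 → v t ≠ 0 →
      (t = s.swap ∨ v s.swap = 0 ∧ v t.swap = 0) → ∃ X ∈ H, HasUnitCoord S (X.1 *ᵥ v) := by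
    intro s t hst hs ht hadm
    rcases le_total (v t).natAbs (v s).natAbs with hle | hle
    · exact hred s t hst hs ht (hadm.imp_right And.left) hle
    · refine hred t s hst.symm ht hs (hadm.imp (fun h => ?_) And.right) hle
      rw [h, Sum.swap_swap]
  have hswap : ∀ s : l ⊕ l, s ≠ s.swap := by rintro (i | i) <;> simp
  obtain ⟨s, hs⟩ : ∃ s, v s ≠ 0 := by
    by_contra! h
    obtain rfl : v = 0 := funext h
    simp [form] at hvw
  by_cases hss : v s.swap ≠ 0
  · exact hpair s s.swap (hswap s) hs hss (.inl rfl)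
  by_cases hex : ∃ t, s ≠ t ∧ v t ≠ 0
  · obtain ⟨t, hst, ht⟩ := hex
    by_cases hts : v t.swap ≠ 0
    · exact hpair t t.swap (hswap t) ht hts (.inl rfl)
    · exact hpair s t hst hs ht (.inr ⟨not_not.mp hss, not_not.mp hts⟩)
  push Not at hex
  have hvs : v = v s • basisVec s := by
    funext t
    by_cases hst : s = t
    · simp [hst]
    · simp [hex t hst, Ne.symm hst]
  refine ⟨1, H.one_mem, ?_⟩
  rw [show (1 : symplecticGroup l ℤ).1 *ᵥ v = v from one_mulVec v]
  refine ⟨hv, s, ?_⟩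
  rw [hvs, form_smul_left] at hvw
  exact isUnit_of_mul_isUnit_left hvw

/-- `Sp_{2g}(ℤ)` is perfect for `g ≥ 3`. -/
theorem monoidHom_eq_one (hl : 3 ≤ Fintype.card l) {A : Type*} [CommGroup A]
    (χ : symplecticGroup l ℤ →* A) : χ = 1 := by
  suffices h : ∀ T : Finset l, ∀ X ∈ fixing ((T : Set l)ᶜ), χ X = 1 by
    ext X
    exact h Finset.univ X fun s hs => by simp at hs
  intro T
  induction T using Finset.induction_on with
  | empty =>
    intro X hX
    have : X = 1 := Subtype.ext <| Matrix.ext_of_mulVec_single fun s => by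
      rw [hX s (by simp)]
      exact (one_mulVec _).symm
    rw [this, map_one]
  | insert i T hi ih =>
    intro X hX
    set S : Set l := ((insert i T : Finset l) : Set l)ᶜ with hS
    have hiS : i ∉ S := by simp [hS]
    let H : Subgroup (symplecticGroup l ℤ) := χ.ker ⊓ fixing S
    have hH : ∀ u, HasUnitCoord S u → ∀ k, transvection k u ∈ H := fun u hu k =>
      ⟨map_transvection_eq_one hl χ ⟨fun _ h => h.elim, hu.2⟩ k, transvection_mem_fixing hu.1 k⟩
    have he : HasUnitCoord S (basisVec (.inl i)) := hasUnitCoord_basisVec hiS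
    have hf : HasUnitCoord S (basisVec (.inr i)) := hasUnitCoord_basisVec hiS
    obtain ⟨Y, hY, hYX⟩ := exists_mem_hasUnitCoord_mulVec hH inf_le_right (he.1.mulVec hX)
      (w := X.1 *ᵥ basisVec (.inr i)) (by rw [form_coe_mulVec, form_basisVec_inr]; simp)
    obtain ⟨Z, hZ, hZYX⟩ := exists_mem_mulVec_eq hH hYX he
    -- `W` fixes the first vector of the `i`-th plane
    let W := Z * Y * X
    have hWS : W ∈ fixing S := mul_mem (mul_mem hZ.2 hY.2) hX
    have hWe : W.1 *ᵥ basisVec (.inl i) = basisVec (.inl i) := by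
      simp only [W, coe_mul_mulVec]
      exact hZYX
    have hχW : χ W = χ X := by
      simp only [W, map_mul, MonoidHom.mem_ker.mp hZ.1, MonoidHom.mem_ker.mp hY.1, one_mul]
    set w := W.1 *ᵥ basisVec (.inr i) with hw
    have hwS : SupportedOff S w := hf.1.mulVec hWS
    have hwi : w (.inr i) = 1 := by
      rw [← form_basisVec_inl w i, ← hWe, hw, form_coe_mulVec, form_basisVec_inl]
      simp
    set k : ℤ := 1 - w (.inl i) with hk
    set u := w + k • basisVec (.inl i) - basisVec (.inr i) with hu
    have huS : SupportedOff S u := by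
      intro j hj
      have hji : j ≠ i := by rintro rfl; exact hiS hj
      simp [hu, hwS j hj, hji]
    have hul : u (.inl i) = 1 := by simp [hu, hk]
    have hur : u (.inr i) = 0 := by simp [hu, hwi]
    have huU : HasUnitCoord S u := ⟨huS, .inl i, by simp [hul]⟩
    have h₁ := hH _ he k
    have h₂ := hH _ huU (-1)
    have hfix : transvection (-1) u * transvection k (basisVec (.inl i)) * W ∈
        fixing ((T : Set l)ᶜ) := by
      intro s hs
      by_cases hsi : s.elim id id = i
      · have hse : s = .inl i ∨ s = .inr i := by
          rcases s with j | j <;> simp_all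
        have heu : form (basisVec (.inl i)) u = 0 := by
          rw [form_eq_neg, form_basisVec_inl, hur, neg_zero]
        rcases hse with rfl | rfl
        · simp only [coe_mul_mulVec, hWe, transvection_mulVec, form_self, heu, mul_zero, zero_smul,
            add_zero]
        · have hw₁ : w + k • basisVec (.inl i) = u + basisVec (.inr i) := by rw [hu]; abel
          have hfu : form (basisVec (.inr i)) u = 1 := by
            rw [form_eq_neg, form_basisVec_inr, hul, neg_neg]
          simp only [coe_mul_mulVec, ← hw, transvection_mulVec, form_basisVec_inl, hwi, mul_one,
            hw₁, form_add_left, form_self, hfu]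
          module
      · have hsS : s.elim id id ∈ S := by
          simp only [hS, Set.mem_compl_iff, Finset.mem_coe, Finset.mem_insert] at hs ⊢
          tauto
        exact mul_mem (mul_mem h₂.2 h₁.2) hWS s hsS
    have := ih _ hfix
    rwa [map_mul, map_mul, MonoidHom.mem_ker.mp h₁.1, MonoidHom.mem_ker.mp h₂.1, one_mul, one_mul,
      hχW] at this

end SymplecticGroup

/-- Let `g ≥ 3` and `N ≥ 1` odd, and let `Γ_g(N) ⊆ Sp_{2g}(ℤ)` be the
principal congruence subgroup of level `N`.  Then the restriction map
`res : H²(Sp_{2g}(ℤ), ℤ) → H²(Γ_g(N), ℤ)` (trivial coefficients) is injective.  Concretely,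
in terms of `2`-cocycles for the trivial action: if a `2`-cocycle `f` on `Sp_{2g}(ℤ)` with
values in `ℤ` restricts to a coboundary on `Γ_g(N)`, then `f` is itself a coboundary. -/
theorem res_h2_injective (g N : ℕ) (hg : 3 ≤ g) (hN : 1 ≤ N) (hNodd : Odd N)
    (f : ↥(Matrix.symplecticGroup (Fin g) ℤ) → ↥(Matrix.symplecticGroup (Fin g) ℤ) → ℤ)
    (hcoc : ∀ a b c, f a b + f (a * b) c = f b c + f a (b * c))
    (hres : ∃ φ : ↥((spIntRed g N).ker) → ℤ,
      ∀ a b : ↥((spIntRed g N).ker), f ↑a ↑b = φ a + φ b - φ (a * b)) :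
    ∃ ψ : ↥(Matrix.symplecticGroup (Fin g) ℤ) → ℤ, ∀ a b, f a b = ψ a + ψ b - ψ (a * b) := by
  obtain ⟨φ, hφ⟩ := hres
  have : NeZero N := ⟨by omega⟩
  have : (spIntRed g N).ker.FiniteIndex := Subgroup.finiteIndex_ker _
  obtain ⟨β, hβ⟩ := exists_index_mul_eq_coboundary (spIntRed g N).ker f hcoc φ hφ
  exact exists_eq_coboundary_of_mul_eq_coboundary _ Subgroup.FiniteIndex.index_ne_zero
    (SymplecticGroup.monoidHom_eq_one (by simpa using hg)) f β hβ
end
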